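/- arXiv:math/0405358 — 2 statements merged into one kernel-verified Lean document; each statement's English description precedes it below -/
import Mathlib

section
/- For the two-coordinate interpolation, for every 0 ≤ t < 1 and every function f on Σ_N^n, ν_t′(f) = I + II + III, where I = β² Σ_{1≤l<l′≤n} ν_t(f σ_N^l σ_N^{l′}(R⁼_{l,l′} − q)) − β² n Σ_{l≤n} ν_t(f σ_N^l σ_N^{n+1}(R⁼_{l,n+1} − q)) + β²(n(n+1)/2) ν_t(f σ_N^{n+1}σ_N^{n+2}(R⁼_{n+1,n+2} − q)); II is the same expression with σ_N replaced everywhere by σ_{N−1}; and III = (β²/N)[ Σ_{1≤l<l′≤n} ν_t(f σ_N^l σ_N^{l′} σ_{N−1}^l σ_{N−1}^{l′}) − n Σ_{l≤n} ν_t(f σ_N^l σ_N^{n+1} σ_{N−1}^l σ_{N−1}^{n+1}) + (n(n+1)/2) ν_t(f σ_N^{n+1} σ_N^{n+2} σ_{N−1}^{n+1} σ_{N−1}^{n+2}) ]. -/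
open MeasureTheory ProbabilityTheory Finset

noncomputable section

/-- A spin configuration on `N` sites. -/
abbrev Cfg (N : ℕ) := Fin N → Bool

/-- The spin value `±1` of a Boolean. -/
def spin (b : Bool) : ℝ := if b then 1 else -1

/-- Minus the SK Hamiltonian. -/
def negH (N : ℕ) (β h : ℝ) (g : Fin N → Fin N → ℝ) (σ : Cfg N) : ℝ :=
  (β / Real.sqrt N) *
      ∑ i : Fin N, ∑ j : Fin N, (if i < j then g i j * spin (σ i) * spin (σ j) else 0) +
    h * ∑ i : Fin N, spin (σ i)

/-- Gibbs average `⟨f⟩` of a function of `ι`-indexed replicas. -/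
def gibbs (N : ℕ) (β h : ℝ) (g : Fin N → Fin N → ℝ) {ι : Type} [DecidableEq ι] [Fintype ι]
    (f : (ι → Cfg N) → ℝ) : ℝ :=
  (∑ σs : ι → Cfg N, f σs * ∏ l, Real.exp (negH N β h g (σs l))) /
    (∑ σ : Cfg N, Real.exp (negH N β h g σ)) ^ (Fintype.card ι)

/-- The law of the disorder: i.i.d. standard Gaussians. -/
def gaussN (N : ℕ) : Measure (Fin N → Fin N → ℝ) :=
  Measure.pi fun _ => Measure.pi fun _ => gaussianReal 0 1

/-- `ν(f) = E⟨f⟩`. -/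
def nu (N : ℕ) (β h : ℝ) {ι : Type} [DecidableEq ι] [Fintype ι]
    (f : (ι → Cfg N) → ℝ) : ℝ :=
  ∫ g, gibbs N β h g f ∂ gaussN N

/-- `S_l = Σ_i t_i (σ_i^{1(l)} - σ_i^{2(l)})`, replica pairs indexed by `Fin m × Fin 2`. -/
def Sbar (N m : ℕ) (t : Fin N → ℝ) (σs : Fin m × Fin 2 → Cfg N) (l : Fin m) : ℝ :=
  ∑ i, t i * (spin (σs (l, 0) i) - spin (σs (l, 1) i))

/-- `a(k)`: the `k`-th moment of a standard Gaussian. -/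
def gaussMoment (k : ℕ) : ℝ := ∫ x, x ^ k ∂ (gaussianReal 0 1 : Measure ℝ)

/-- The overlap `R_{l,l'}` of two configurations. -/
def overlap (N : ℕ) (σ τ : Cfg N) : ℝ := (∑ i, spin (σ i) * spin (τ i)) / N

/-- Minus the two-coordinate interpolating Hamiltonian (here `N = M+2`; the last two coordinates
`σ_N, σ_{N-1}` play the special role, `z₁, z₂` are extra standard Gaussians). -/
def negHt2 (M : ℕ) (β h q s : ℝ) (g : Fin (M + 2) → Fin (M + 2) → ℝ) (z₁ z₂ : ℝ)
    (σ : Cfg (M + 2)) : ℝ :=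
  (β / Real.sqrt (M + 2)) *
      ∑ i : Fin M, ∑ j : Fin M,
        (if i < j then
          g i.castSucc.castSucc j.castSucc.castSucc *
            spin (σ i.castSucc.castSucc) * spin (σ j.castSucc.castSucc) else 0) +
    Real.sqrt s *
      (spin (σ (Fin.last (M + 1))) * (β / Real.sqrt (M + 2)) *
          ∑ i : Fin M, g i.castSucc.castSucc (Fin.last (M + 1)) * spin (σ i.castSucc.castSucc) +
        spin (σ (Fin.last M).castSucc) * (β / Real.sqrt (M + 2)) *
          ∑ i : Fin M, g i.castSucc.castSucc (Fin.last M).castSucc *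
            spin (σ i.castSucc.castSucc) +
        (β / Real.sqrt (M + 2)) * g (Fin.last M).castSucc (Fin.last (M + 1)) *
          spin (σ (Fin.last M).castSucc) * spin (σ (Fin.last (M + 1)))) +
    β * Real.sqrt (1 - s) *
      (z₁ * Real.sqrt q * spin (σ (Fin.last (M + 1))) +
        z₂ * Real.sqrt q * spin (σ (Fin.last M).castSucc)) +
    h * ∑ i, spin (σ i)

/-- Gibbs average `⟨f⟩_t` for the two-coordinate interpolating Hamiltonian. -/
def gibbsT2 (M : ℕ) (β h q s : ℝ) (g : Fin (M + 2) → Fin (M + 2) → ℝ) (z₁ z₂ : ℝ)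
    {ι : Type} [DecidableEq ι] [Fintype ι] (f : (ι → Cfg (M + 2)) → ℝ) : ℝ :=
  (∑ σs : ι → Cfg (M + 2), f σs * ∏ l, Real.exp (negHt2 M β h q s g z₁ z₂ (σs l))) /
    (∑ σ : Cfg (M + 2), Real.exp (negHt2 M β h q s g z₁ z₂ σ)) ^ (Fintype.card ι)

/-- `ν_t(f) = E⟨f⟩_t` for the two-coordinate interpolation; `ν_t` at `t = 0` is `ν₀₀`. -/
def nuT2 (M : ℕ) (β h q s : ℝ) {ι : Type} [DecidableEq ι] [Fintype ι]
    (f : (ι → Cfg (M + 2)) → ℝ) : ℝ :=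
  ∫ gz : (Fin (M + 2) → Fin (M + 2) → ℝ) × (ℝ × ℝ),
    gibbsT2 M β h q s gz.1 gz.2.1 gz.2.2 f
    ∂ (gaussN (M + 2)).prod ((gaussianReal 0 1).prod (gaussianReal 0 1))

/-- The doubly truncated overlap `R⁼_{l,l'} = N^{-1} Σ_{i ≤ N-2} σ_i^l σ_i^{l'}` (`N = M+2`). -/
def overlapEq (M : ℕ) (σ τ : Cfg (M + 2)) : ℝ :=
  (∑ i : Fin M, spin (σ i.castSucc.castSucc) * spin (τ i.castSucc.castSucc)) / (M + 2)
/-- Generic term `ν_t(f σ_c^a σ_c^b (R⁼_{a,b} − q))` appearing in the derivative formula for the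
two-coordinate interpolation (`c` is the coordinate `N` or `N−1`). -/
def dTerm (M n : ℕ) (β h q s : ℝ) (f : (Fin n → Cfg (M + 2)) → ℝ) (c : Fin (M + 2))
    (a b : Fin (n + 2)) : ℝ :=
  nuT2 M β h q s (fun σs : Fin (n + 2) → Cfg (M + 2) =>
    f (fun j => σs (j.castLE (by omega))) * spin (σs a c) * spin (σs b c) *
      (overlapEq M (σs a) (σs b) - q))

/-- Generic term `ν_t(f σ_N^a σ_N^b σ_{N-1}^a σ_{N-1}^b)` appearing in the derivative formula. -/
def dTerm2 (M n : ℕ) (β h q s : ℝ) (f : (Fin n → Cfg (M + 2)) → ℝ) (a b : Fin (n + 2)) : ℝ :=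
  nuT2 M β h q s (fun σs : Fin (n + 2) → Cfg (M + 2) =>
    f (fun j => σs (j.castLE (by omega))) *
      spin (σs a (Fin.last (M + 1))) * spin (σs b (Fin.last (M + 1))) *
      spin (σs a (Fin.last M).castSucc) * spin (σs b (Fin.last M).castSucc))

/-- Gaussian integration by parts for the linear functional `L` in the direction `e`. -/
structure GaussianIBP {Ω : Type*} [NormedAddCommGroup Ω] [NormedSpace ℝ Ω] [MeasurableSpace Ω]
    (μ : Measure Ω) (L : Ω → ℝ) (e : Ω) : Prop where
  integrable : Integrable L μ
  integral_mul : ∀ φ φ' : Ω → ℝ, Continuous φ → Continuous φ' → (∃ C, ∀ ω, |φ ω| ≤ C) →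
    (∃ C, ∀ ω, |φ' ω| ≤ C) → (∀ ω, HasDerivAt (fun r : ℝ => φ (ω + r • e)) (φ' ω) 0) →
    ∫ ω, L ω * φ ω ∂μ = ∫ ω, φ' ω ∂μ

lemma integrable_of_continuous_of_bound {Ω : Type*} [TopologicalSpace Ω] [MeasurableSpace Ω]
    [OpensMeasurableSpace Ω] (μ : Measure Ω) [IsFiniteMeasure μ] {φ : Ω → ℝ}
    (hφ : Continuous φ) {C : ℝ} (hC : ∀ ω, |φ ω| ≤ C) : Integrable φ μ :=
  Integrable.of_bound hφ.measurable.aestronglyMeasurable C (ae_of_all _ hC)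

lemma integrable_id_gaussianReal : Integrable (fun x : ℝ => x) (gaussianReal 0 1) :=
  (memLp_id_gaussianReal' 1 (by simp)).integrable le_rfl

lemma integrable_gaussianReal_iff {f : ℝ → ℝ} :
    Integrable f (gaussianReal 0 1) ↔ Integrable (fun x => gaussianPDFReal 0 1 x * f x) := by
  rw [gaussianReal_of_var_ne_zero _ one_ne_zero, integrable_withDensity_iff_integrable_smul']
  · simp [toReal_gaussianPDF]
  · exact measurable_gaussianPDF _ _
  · exact ae_of_all _ fun _ => gaussianPDF_lt_top

lemma hasDerivAt_gaussianPDFReal (x : ℝ) :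
    HasDerivAt (gaussianPDFReal 0 1) (-x * gaussianPDFReal 0 1 x) x := by
  have h : HasDerivAt (fun x : ℝ => -(x - 0) ^ 2 / (2 * ((1 : NNReal) : ℝ))) (-x) x := by
    have := ((((hasDerivAt_id x).sub_const 0).pow 2).neg).div_const (2 * ((1 : NNReal) : ℝ))
    refine this.congr_deriv ?_
    simp
    ring
  rw [gaussianPDFReal_def]
  refine ((h.exp).const_mul _).congr_deriv ?_
  ring

lemma gaussianIBP_gaussianReal : GaussianIBP (gaussianReal 0 1) (fun x : ℝ => x) 1 where
  integrable := integrable_id_gaussianReal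
  integral_mul := by
    rintro φ φ' hφ hφ' ⟨C, hC⟩ ⟨C', hC'⟩ hd
    have hi1 : Integrable φ' (gaussianReal 0 1) := integrable_of_continuous_of_bound _ hφ' hC'
    have hi0 : Integrable φ (gaussianReal 0 1) := integrable_of_continuous_of_bound _ hφ hC
    have hi2 : Integrable (fun x => x * φ x) (gaussianReal 0 1) :=
      integrable_id_gaussianReal.mul_bdd hφ.measurable.aestronglyMeasurable (ae_of_all _ hC)
    have hderiv : ∀ x, HasDerivAt (fun x => gaussianPDFReal 0 1 x * φ x)
        (gaussianPDFReal 0 1 x * φ' x - gaussianPDFReal 0 1 x * (x * φ x)) x := by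
      intro x
      have h1 : HasDerivAt φ (φ' x) x := by
        have h := hd x
        simp only [smul_eq_mul, mul_one] at h
        have h0 : HasDerivAt (fun r => φ (x + r)) (φ' x) (x - x) := by simpa using h
        simpa using h0.comp_sub_const x x
      refine ((hasDerivAt_gaussianPDFReal x).mul h1).congr_deriv ?_
      ring
    have key := integral_eq_zero_of_hasDerivAt_of_integrable hderiv
      ((integrable_gaussianReal_iff.1 hi1).sub (integrable_gaussianReal_iff.1 hi2))
      (integrable_gaussianReal_iff.1 hi0)
    rw [integral_sub (integrable_gaussianReal_iff.1 hi1) (integrable_gaussianReal_iff.1 hi2)] at key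
    rw [integral_gaussianReal_eq_integral_smul one_ne_zero,
      integral_gaussianReal_eq_integral_smul one_ne_zero]
    simp only [smul_eq_mul]
    linarith

section Product

variable {Ω Ω' : Type*} [NormedAddCommGroup Ω] [NormedSpace ℝ Ω] [MeasurableSpace Ω]
  [BorelSpace Ω] [SecondCountableTopology Ω] [NormedAddCommGroup Ω'] [NormedSpace ℝ Ω']
  [MeasurableSpace Ω'] [BorelSpace Ω'] [SecondCountableTopology Ω']
  {μ : Measure Ω} {μ' : Measure Ω'} [IsProbabilityMeasure μ] [IsProbabilityMeasure μ']

lemma GaussianIBP.prod_fst {L : Ω → ℝ} {e : Ω} (h : GaussianIBP μ L e) :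
    GaussianIBP (μ.prod μ') (fun ω => L ω.1) (e, 0) where
  integrable := h.integrable.comp_fst μ'
  integral_mul := by
    rintro φ φ' hφ hφ' ⟨C, hC⟩ ⟨C', hC'⟩ hd
    have hi : Integrable (fun ω : Ω × Ω' => L ω.1 * φ ω) (μ.prod μ') :=
      (h.integrable.comp_fst μ').mul_bdd hφ.measurable.aestronglyMeasurable (ae_of_all _ hC)
    have hi' : Integrable φ' (μ.prod μ') := integrable_of_continuous_of_bound _ hφ' hC'
    rw [integral_prod_symm _ hi, integral_prod_symm _ hi']
    congr 1
    ext y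
    refine h.integral_mul (fun x => φ (x, y)) (fun x => φ' (x, y)) (by fun_prop) (by fun_prop)
      ⟨C, fun x => hC _⟩ ⟨C', fun x => hC' _⟩ fun x => ?_
    simpa using hd (x, y)

omit [SecondCountableTopology Ω] [SecondCountableTopology Ω'] [IsProbabilityMeasure μ]
  [IsProbabilityMeasure μ'] [BorelSpace Ω] [BorelSpace Ω'] in
lemma GaussianIBP.of_measurePreserving {L : Ω → ℝ} {L' : Ω' → ℝ} {e : Ω} {e' : Ω'}
    (T : Ω ≃ᵐ Ω') (hT : MeasurePreserving T μ μ') (hc : Continuous T)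
    (he : ∀ (ω : Ω) (r : ℝ), T (ω + r • e) = T ω + r • e') (hL : ∀ ω, L' (T ω) = L ω)
    (h : GaussianIBP μ L e) : GaussianIBP μ' L' e' := by
  refine ⟨?_, ?_⟩
  · rw [← hT.integrable_comp_emb T.measurableEmbedding]
    simpa [Function.comp_def, hL] using h.integrable
  · rintro φ φ' hφ hφ' ⟨C, hC⟩ ⟨C', hC'⟩ hd
    rw [← hT.integral_comp T.measurableEmbedding, ← hT.integral_comp T.measurableEmbedding]
    simp only [hL]
    refine h.integral_mul (fun x => φ (T x)) (fun x => φ' (T x)) (hφ.comp hc)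
      (hφ'.comp hc) ⟨C, fun x => hC _⟩ ⟨C', fun x => hC' _⟩ fun x => ?_
    simpa [he] using hd (T x)

lemma GaussianIBP.prod_snd {L : Ω' → ℝ} {e : Ω'} (h : GaussianIBP μ' L e) :
    GaussianIBP (μ.prod μ') (fun ω => L ω.2) (0, e) :=
  (h.prod_fst (μ' := μ)).of_measurePreserving MeasurableEquiv.prodComm
    Measure.measurePreserving_swap continuous_swap (fun _ _ => by simp [MeasurableEquiv.prodComm])
    fun _ => rfl

lemma GaussianIBP.pi {n : ℕ} {L : Ω → ℝ} {e : Ω} (h : GaussianIBP μ L e) (i : Fin n) :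
    GaussianIBP (Measure.pi fun _ : Fin n => μ) (fun ω => L (ω i)) (Pi.single i e) := by
  obtain _ | n := n
  · exact i.elim0
  have hp : GaussianIBP (μ.prod (Measure.pi fun _ : Fin n => μ)) (fun ω => L ω.1) (e, 0) :=
    h.prod_fst
  refine hp.of_measurePreserving (MeasurableEquiv.piFinSuccAbove (fun _ => Ω) i).symm
    ((measurePreserving_piFinSuccAbove (fun _ => μ) i).symm _) ?_ ?_ ?_
  · exact Continuous.finInsertNth (A := fun _ => Ω) i continuous_fst continuous_snd
  · intro ω r
    ext j
    refine Fin.succAboveCases i ?_ (fun j => ?_) j <;>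
      simp [MeasurableEquiv.piFinSuccAbove_symm_apply]
  · intro ω
    simp [MeasurableEquiv.piFinSuccAbove_symm_apply]

end Product

section Replicas

variable {S : Type*} [Fintype S]

/-- The Gibbs average over `n` replicas for the energy function `y`. -/
def replicaAvg {n : ℕ} (F : (Fin n → S) → ℝ) (y : S → ℝ) : ℝ :=
  (∑ σs : Fin n → S, F σs * ∏ l, Real.exp (y (σs l))) / (∑ σ, Real.exp (y σ)) ^ n

/-- The `n + 1` replica function whose average is the derivative of the average of `F` in the
direction `a`. -/
def replicaDeriv {n : ℕ} (a : S → ℝ) (F : (Fin n → S) → ℝ) (τ : Fin (n + 1) → S) : ℝ :=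
  F (fun j => τ j.castSucc) * (∑ l : Fin n, a (τ l.castSucc) - n * a (τ (Fin.last n)))

lemma replicaAvg_sum {K : Type*} (s : Finset K) {n : ℕ} (F : K → (Fin n → S) → ℝ) (y : S → ℝ) :
    replicaAvg (fun σs => ∑ k ∈ s, F k σs) y = ∑ k ∈ s, replicaAvg (F k) y := by
  simp only [replicaAvg, Finset.sum_mul, ← Finset.sum_div]
  rw [Finset.sum_comm]

lemma replicaAvg_const_mul {n : ℕ} (c : ℝ) (F : (Fin n → S) → ℝ) (y : S → ℝ) :
    replicaAvg (fun σs => c * F σs) y = c * replicaAvg F y := by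
  simp only [replicaAvg, mul_assoc, ← Finset.mul_sum, mul_div_assoc]

lemma replicaAvg_comp_perm {n : ℕ} (e : Equiv.Perm (Fin n)) (F : (Fin n → S) → ℝ) (y : S → ℝ) :
    replicaAvg (fun σs => F (σs ∘ e)) y = replicaAvg F y := by
  simp only [replicaAvg]
  congr 1
  refine Fintype.sum_equiv (e.symm.arrowCongr (Equiv.refl S)) _ _ fun σs => ?_
  have : (e.symm.arrowCongr (Equiv.refl S)) σs = σs ∘ e := by ext; simp
  rw [this]
  congr 1
  exact (Equiv.prod_comp e fun l => Real.exp (y (σs l))).symm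

variable [Nonempty S]

lemma sum_exp_pos (y : S → ℝ) : 0 < ∑ σ, Real.exp (y σ) :=
  Finset.sum_pos (fun _ _ => Real.exp_pos _) Finset.univ_nonempty

lemma abs_replicaAvg_le {n : ℕ} (F : (Fin n → S) → ℝ) (y : S → ℝ) :
    |replicaAvg F y| ≤ ∑ σs, |F σs| := by
  have hZ := sum_exp_pos y
  rw [replicaAvg, abs_div, abs_of_pos (pow_pos hZ n), div_le_iff₀ (pow_pos hZ n), Finset.sum_mul]
  refine (Finset.abs_sum_le_sum_abs _ _).trans (Finset.sum_le_sum fun σs _ => ?_)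
  rw [abs_mul, abs_of_pos (Finset.prod_pos fun _ _ => Real.exp_pos _)]
  gcongr
  calc ∏ l, Real.exp (y (σs l)) ≤ ∏ _l : Fin n, ∑ σ, Real.exp (y σ) :=
        Finset.prod_le_prod (fun _ _ => (Real.exp_pos _).le) fun l _ =>
          Finset.single_le_sum (f := fun σ => Real.exp (y σ)) (fun _ _ => (Real.exp_pos _).le)
            (Finset.mem_univ _)
    _ = _ := by simp

lemma continuous_replicaAvg {n : ℕ} (F : (Fin n → S) → ℝ) : Continuous (replicaAvg F) := by
  unfold replicaAvg
  exact Continuous.div (by fun_prop) (by fun_prop) fun y => (pow_pos (sum_exp_pos y) n).ne'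

lemma HasDerivAt.replicaAvg {n : ℕ} (F : (Fin n → S) → ℝ) {y : ℝ → S → ℝ} {a : S → ℝ} {u : ℝ}
    (hy : ∀ σ, HasDerivAt (fun v => y v σ) (a σ) u) :
    HasDerivAt (fun v => replicaAvg F (y v)) (replicaAvg (replicaDeriv a F) (y u)) u := by
  have hZ := sum_exp_pos (y u)
  have hA : HasDerivAt (fun v => ∑ σs : Fin n → S, F σs * ∏ l, Real.exp (y v (σs l)))
      (∑ σs : Fin n → S, F σs * ((∏ l, Real.exp (y u (σs l))) * ∑ l, a (σs l))) u := by
    refine HasDerivAt.fun_sum fun σs _ => HasDerivAt.const_mul _ ?_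
    simp only [← Real.exp_sum]
    exact (HasDerivAt.fun_sum fun l _ => hy (σs l)).exp
  have hB : HasDerivAt (fun v => ∑ σ, Real.exp (y v σ)) (∑ σ, Real.exp (y u σ) * a σ) u :=
    HasDerivAt.fun_sum fun σ _ => (hy σ).exp
  refine (hA.div (hB.pow n) (pow_pos hZ n).ne').congr_deriv ?_
  have hnum : ∑ τ : Fin (n + 1) → S, replicaDeriv a F τ * ∏ l, Real.exp (y u (τ l)) =
      (∑ σs : Fin n → S, F σs * ((∏ l, Real.exp (y u (σs l))) * ∑ l, a (σs l))) *
          (∑ σ, Real.exp (y u σ)) -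
        n * (∑ σs : Fin n → S, F σs * ∏ l, Real.exp (y u (σs l))) *
          ∑ σ, Real.exp (y u σ) * a σ := by
    rw [← (Fin.snocEquiv fun _ => S).sum_comp, Fintype.sum_prod_type_right,
      Finset.sum_mul_sum, mul_assoc, Finset.sum_mul_sum, Finset.mul_sum, ← Finset.sum_sub_distrib]
    refine Finset.sum_congr rfl fun σs _ => ?_
    rw [Finset.mul_sum _ _ (n : ℝ), ← Finset.sum_sub_distrib]
    refine Finset.sum_congr rfl fun σ _ => ?_
    simp only [replicaDeriv, Fin.snocEquiv, Equiv.coe_fn_mk, Fin.snoc_castSucc, Fin.snoc_last,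
      Fin.prod_univ_castSucc]
    ring
  rw [_root_.replicaAvg, hnum]
  obtain _ | n := n
  · simp
  · simp only [Pi.pow_apply, Nat.add_sub_cancel]
    field_simp
    ring

end Replicas

section Interpolation

variable {S K Ω : Type*} [Fintype S] [Nonempty S] [Fintype K] [DecidableEq K]
  [NormedAddCommGroup Ω] [NormedSpace ℝ Ω] [MeasurableSpace Ω] [BorelSpace Ω]

/-- A random energy with Gaussian coefficients `X k` of standard deviation `c k`. -/
def gaussEnergy (X : K → Ω → ℝ) (a : K → S → ℝ) (b : Ω → S → ℝ) (c : K → ℝ) (ω : Ω) (σ : S) : ℝ :=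
  ∑ k, c k * X k ω * a k σ + b ω σ

omit [Fintype S] [Nonempty S] [DecidableEq K] [NormedSpace ℝ Ω] [MeasurableSpace Ω]
  [BorelSpace Ω] in
lemma continuous_gaussEnergy {X : K → Ω → ℝ} {a : K → S → ℝ} {b : Ω → S → ℝ}
    (hX : ∀ k, Continuous (X k)) (hb : Continuous b) (c : K → ℝ) :
    Continuous (gaussEnergy X a b c) := by
  unfold gaussEnergy
  fun_prop

omit [Fintype S] [Nonempty S] [DecidableEq K] in
lemma replicaDeriv_sum {n : ℕ} (w : K → ℝ) (a : K → S → ℝ) (F : (Fin n → S) → ℝ) :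
    replicaDeriv (fun σ => ∑ k, w k * a k σ) F = fun τ => ∑ k, w k * replicaDeriv (a k) F τ := by
  ext τ
  simp only [replicaDeriv]
  rw [Finset.sum_comm, Finset.mul_sum, ← Finset.sum_sub_distrib, Finset.mul_sum]
  refine Finset.sum_congr rfl fun k _ => ?_
  rw [← Finset.mul_sum]
  ring

variable {μ : Measure Ω} [IsProbabilityMeasure μ]

omit [NormedSpace ℝ Ω] in
lemma integrable_replicaAvg {n : ℕ} (F : (Fin n → S) → ℝ) {y : Ω → S → ℝ} (hy : Continuous y) :
    Integrable (fun ω => replicaAvg F (y ω)) μ :=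
  integrable_of_continuous_of_bound μ ((continuous_replicaAvg F).comp hy)
    fun _ => abs_replicaAvg_le F _

variable {X : K → Ω → ℝ} {e : K → Ω} {a : K → S → ℝ} {b : Ω → S → ℝ}

omit [BorelSpace Ω] [IsProbabilityMeasure μ] in
lemma integral_mul_replicaAvg_gaussEnergy (hX : ∀ k, GaussianIBP μ (X k) (e k))
    (hXc : ∀ k, Continuous (X k)) (hb : Continuous b)
    (hXe : ∀ j k ω (r : ℝ), X j (ω + r • e k) = X j ω + if j = k then r else 0)
    (hbe : ∀ k ω (r : ℝ), b (ω + r • e k) = b ω) (c : K → ℝ) {n : ℕ} (F : (Fin n → S) → ℝ)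
    (k : K) :
    ∫ ω, X k ω * replicaAvg F (gaussEnergy X a b c ω) ∂μ =
      ∫ ω, c k * replicaAvg (replicaDeriv (a k) F) (gaussEnergy X a b c ω) ∂μ := by
  have hE := continuous_gaussEnergy (a := a) hXc hb c
  refine (hX k).integral_mul _ _ ((continuous_replicaAvg F).comp hE)
    (((continuous_replicaAvg _).comp hE).const_mul _) ⟨_, fun _ => abs_replicaAvg_le F _⟩
    ⟨|c k| * ∑ τ, |replicaDeriv (a k) F τ|, fun ω => ?_⟩ fun ω => ?_
  · rw [abs_mul]
    exact mul_le_mul_of_nonneg_left (abs_replicaAvg_le _ _) (abs_nonneg _)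
  · rw [← replicaAvg_const_mul]
    have h := HasDerivAt.replicaAvg (u := 0) F (y := fun r => gaussEnergy X a b c (ω + r • e k))
      (a := fun σ => c k * a k σ) fun σ => ?_
    · refine h.congr_deriv ?_
      simp only [zero_smul, add_zero]
      congr 1
      ext τ
      simp only [replicaDeriv, ← Finset.mul_sum]
      ring
    · have : ∀ r : ℝ, gaussEnergy X a b c (ω + r • e k) σ =
          gaussEnergy X a b c ω σ + r * (c k * a k σ) := by
        intro r
        simp only [gaussEnergy, hXe, hbe, mul_add, add_mul, Finset.sum_add_distrib, mul_ite,
          ite_mul, mul_zero, zero_mul, Finset.sum_ite_eq', Finset.mem_univ, if_true]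
        ring
      simp only [this]
      simpa using ((hasDerivAt_id (0 : ℝ)).mul_const (c k * a k σ)).const_add
        (gaussEnergy X a b c ω σ)

/-- Derivative of a Gaussian interpolation. -/
lemma hasDerivAt_integral_replicaAvg (hX : ∀ k, GaussianIBP μ (X k) (e k))
    (hXc : ∀ k, Continuous (X k)) (hb : Continuous b)
    (hXe : ∀ j k ω (r : ℝ), X j (ω + r • e k) = X j ω + if j = k then r else 0)
    (hbe : ∀ k ω (r : ℝ), b (ω + r • e k) = b ω) {c c' : ℝ → K → ℝ} {s : ℝ}
    (hc : ∀ k, ∀ᶠ u in nhds s, HasDerivAt (fun v => c v k) (c' u k) u)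
    (hc' : ∀ k, ContinuousAt (fun u => c' u k) s) {n : ℕ} (F : (Fin n → S) → ℝ) :
    HasDerivAt (fun u => ∫ ω, replicaAvg F (gaussEnergy X a b (c u) ω) ∂μ)
      (∫ ω, replicaAvg
        (fun τ => ∑ k, c s k * c' s k * replicaDeriv (a k) (replicaDeriv (a k) F) τ)
        (gaussEnergy X a b (c s) ω) ∂μ) s := by
  have hE := fun u => continuous_gaussEnergy (a := a) hXc hb (c u)
  let D : ℝ → Ω → ℝ := fun u ω =>
    ∑ k, c' u k * (X k ω * replicaAvg (replicaDeriv (a k) F) (gaussEnergy X a b (c u) ω))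
  have hcont : ∀ G : (Fin (n + 1) → S) → ℝ, ∀ u,
      Continuous fun ω => replicaAvg G (gaussEnergy X a b (c u) ω) :=
    fun G u => (continuous_replicaAvg G).comp (hE u)
  have hev : {u | (∀ k, HasDerivAt (fun v => c v k) (c' u k) u) ∧
      ∀ k, |c' u k| ≤ |c' s k| + 1} ∈ nhds s := by
    refine Filter.inter_mem (Filter.eventually_all.2 hc) (Filter.eventually_all.2 fun k => ?_)
    filter_upwards [(hc' k).abs.eventually_lt_const (lt_add_one |c' s k|)] with u hu using hu.le
  have hderiv := (hasDerivAt_integral_of_dominated_loc_of_deriv_le (μ := μ) (x₀ := s) (F' := D)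
    (F := fun u ω => replicaAvg F (gaussEnergy X a b (c u) ω))
    (bound := fun ω => ∑ k, (|c' s k| + 1) * (|X k ω| * ∑ τ, |replicaDeriv (a k) F τ|)) hev
    (Filter.Eventually.of_forall fun u =>
      ((continuous_replicaAvg F).comp (hE u)).measurable.aestronglyMeasurable)
    (integrable_replicaAvg F (hE s)) ?_ (ae_of_all _ ?_) ?_ (ae_of_all _ ?_)).2
  · refine hderiv.congr_deriv ?_
    simp only [D]
    rw [integral_finsetSum]
    · simp only [replicaAvg_sum, replicaAvg_const_mul]
      rw [integral_finsetSum]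
      · refine Finset.sum_congr rfl fun k _ => ?_
        rw [integral_const_mul, integral_mul_replicaAvg_gaussEnergy hX hXc hb hXe hbe,
          integral_const_mul, integral_const_mul]
        ring
      · exact fun k _ => (integrable_replicaAvg _ (hE s)).const_mul _
    · exact fun k _ => ((hX k).integrable.mul_bdd (hcont _ s).measurable.aestronglyMeasurable
        (ae_of_all _ fun ω => abs_replicaAvg_le _ _)).const_mul _
  · exact (continuous_finsetSum _ fun k _ =>
      ((hXc k).mul (hcont _ s)).const_mul _).measurable.aestronglyMeasurable
  · intro ω u hu
    refine (Finset.abs_sum_le_sum_abs _ _).trans (Finset.sum_le_sum fun k _ => ?_)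
    rw [abs_mul, abs_mul]
    gcongr
    · exact hu.2 k
    · exact abs_replicaAvg_le _ _
  · exact integrable_finsetSum _ fun k _ => ((hX k).integrable.abs.mul_const _).const_mul _
  · intro ω u hu
    have h := HasDerivAt.replicaAvg F (y := fun v => gaussEnergy X a b (c v) ω)
      (a := fun σ => ∑ k, (c' u k * X k ω) * a k σ) (u := u) fun σ =>
        (HasDerivAt.fun_sum fun k _ => ((hu.1 k).mul_const (X k ω)).mul_const (a k σ)).add_const _
    refine h.congr_deriv ?_
    rw [replicaDeriv_sum, replicaAvg_sum]
    simp only [replicaAvg_const_mul, D, mul_assoc]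

/-- Derivative of a Gaussian interpolation on `[0, 1)`, where the standard deviations need not be
differentiable at `0` provided that the variances are. -/
lemma hasDerivWithinAt_integral_replicaAvg (hX : ∀ k, GaussianIBP μ (X k) (e k))
    (hXc : ∀ k, Continuous (X k)) (hb : Continuous b)
    (hXe : ∀ j k ω (r : ℝ), X j (ω + r • e k) = X j ω + if j = k then r else 0)
    (hbe : ∀ k ω (r : ℝ), b (ω + r • e k) = b ω) {c c' : ℝ → K → ℝ} {d : K → ℝ}
    (hc : ∀ k, ∀ u ∈ Set.Ioo (0 : ℝ) 1, HasDerivAt (fun v => c v k) (c' u k) u)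
    (hc' : ∀ k, ContinuousOn (fun u => c' u k) (Set.Ioo (0 : ℝ) 1))
    (hc0 : ∀ k, Continuous (fun u => c u k))
    (hd : ∀ k, ∀ u ∈ Set.Ioo (0 : ℝ) 1, c u k * c' u k = d k / 2)
    {n : ℕ} (F : (Fin n → S) → ℝ) {s : ℝ} (hs : s ∈ Set.Ico (0 : ℝ) 1) :
    HasDerivWithinAt (fun u => ∫ ω, replicaAvg F (gaussEnergy X a b (c u) ω) ∂μ)
      (∫ ω, replicaAvg
        (fun τ => ∑ k, d k / 2 * replicaDeriv (a k) (replicaDeriv (a k) F) τ)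
        (gaussEnergy X a b (c s) ω) ∂μ) (Set.Ico 0 1) s := by
  have hE := fun u => continuous_gaussEnergy (a := a) hXc hb (c u)
  have hcont : ∀ (m : ℕ) (G : (Fin m → S) → ℝ),
      Continuous fun u => ∫ ω, replicaAvg G (gaussEnergy X a b (c u) ω) ∂μ := by
    intro m G
    refine continuous_of_dominated
      (fun u => ((continuous_replicaAvg G).comp (hE u)).measurable.aestronglyMeasurable)
      (fun u => ae_of_all _ fun ω => abs_replicaAvg_le G _) (integrable_const _)
      (ae_of_all _ fun ω => (continuous_replicaAvg G).comp ?_)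
    unfold gaussEnergy
    fun_prop
  have hIoo : ∀ u ∈ Set.Ioo (0 : ℝ) 1,
      HasDerivAt (fun u => ∫ ω, replicaAvg F (gaussEnergy X a b (c u) ω) ∂μ)
      (∫ ω, replicaAvg
        (fun τ => ∑ k, d k / 2 * replicaDeriv (a k) (replicaDeriv (a k) F) τ)
        (gaussEnergy X a b (c u) ω) ∂μ) u := by
    intro u hu
    have hu' := isOpen_Ioo.mem_nhds hu
    have h := hasDerivAt_integral_replicaAvg (a := a) hX hXc hb hXe hbe (c := c) (c' := c') (s := u)
      (fun k => Filter.mem_of_superset hu' (hc k)) (fun k => (hc' k).continuousAt hu') F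
    simpa only [hd _ u hu] using h
  rcases hs.1.eq_or_lt with rfl | h0
  · refine (hasDerivWithinAt_Ici_of_tendsto_deriv (s := Set.Ioo 0 1)
      (fun u hu => (hIoo u hu).differentiableAt.differentiableWithinAt)
      (hcont _ _).continuousWithinAt (Ioo_mem_nhdsGT one_pos) ?_).mono Set.Ico_subset_Ici_self
    refine (((hcont _ _).tendsto 0).mono_left nhdsWithin_le_nhds).congr' ?_
    filter_upwards [Ioo_mem_nhdsGT (one_pos (α := ℝ))] with u hu using (hIoo u hu).deriv.symm
  · exact (hIoo s ⟨h0, hs.2⟩).hasDerivWithinAt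

end Interpolation

section SecondDerivative

lemma sum_sum_eq_two_mul_sum_lt {n : ℕ} (A : Fin n → Fin n → ℝ) (hA : ∀ i j, A i j = A j i) :
    ∑ i, ∑ j, A i j = 2 * (∑ i, ∑ j, if i < j then A i j else 0) + ∑ i, A i i := by
  have h : ∀ i j, A i j = (if i < j then A i j else 0) + (if j < i then A j i else 0) +
      if i = j then A i i else 0 := by
    intro i j
    rcases lt_trichotomy i j with h | rfl | h
    · simp [h, h.not_gt, h.ne]
    · simp
    · simp [h, h.not_gt, h.ne', hA i j]
  calc ∑ i, ∑ j, A i j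
      = ∑ i, ∑ j, ((if i < j then A i j else 0) + (if j < i then A j i else 0) +
          if i = j then A i i else 0) := by simp only [← h]
    _ = _ := by
      simp only [Finset.sum_add_distrib, Finset.sum_ite_eq, Finset.mem_univ, if_true]
      rw [Finset.sum_comm (f := fun i j => if j < i then A j i else 0)]
      ring

variable {S K : Type*} [Fintype S] [Fintype K]

omit [Fintype S] in
lemma sum_replicaDeriv_replicaDeriv {n : ℕ} (F : (Fin n → S) → ℝ) {a : K → S → ℝ} {d : K → ℝ}
    {D : S → S → ℝ} (hD : ∀ σ τ, ∑ k, d k * a k σ * a k τ = D σ τ) {C : ℝ} (hC : ∀ σ, D σ σ = C)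
    (τ : Fin (n + 2) → S) :
    ∑ k, d k / 2 * replicaDeriv (a k) (replicaDeriv (a k) F) τ =
      (∑ l : Fin n, ∑ l' : Fin n, if l < l' then F (fun j => τ j.castSucc.castSucc) *
          D (τ l.castSucc.castSucc) (τ l'.castSucc.castSucc) else 0) +
        ((1 - n) / 2 * ∑ l : Fin n, F (fun j => τ j.castSucc.castSucc) *
          D (τ l.castSucc.castSucc) (τ (Fin.last n).castSucc)) +
        (-((n : ℝ) + 1) / 2 * ∑ l : Fin n, F (fun j => τ j.castSucc.castSucc) *
          D (τ l.castSucc.castSucc) (τ (Fin.last (n + 1)))) +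
        (n : ℝ) * (n + 1) / 2 * (F (fun j => τ j.castSucc.castSucc) *
          D (τ (Fin.last n).castSucc) (τ (Fin.last (n + 1)))) := by
  have hsymm : ∀ σ τ, D σ τ = D τ σ := fun σ τ => by
    rw [← hD, ← hD]
    exact Finset.sum_congr rfl fun k _ => by ring
  set G := F (fun j => τ j.castSucc.castSucc)
  set x : Fin n → S := fun l => τ l.castSucc.castSucc
  set p := τ (Fin.last n).castSucc
  set r := τ (Fin.last (n + 1))
  have hk : ∀ k, d k / 2 * replicaDeriv (a k) (replicaDeriv (a k) F) τ =
      G / 2 * (∑ l, ∑ l', d k * a k (x l) * a k (x l') + (1 - n) * ∑ l, d k * a k (x l) * a k p -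
        (n + 1) * (∑ l, d k * a k (x l) * a k r) - n * (d k * a k p * a k p) +
        n * (n + 1) * (d k * a k p * a k r)) := by
    intro k
    have h1 : ∑ l, ∑ l', d k * a k (x l) * a k (x l') =
        d k * (∑ l, a k (x l)) * ∑ l, a k (x l) := by
      rw [mul_assoc, Finset.sum_mul_sum, Finset.mul_sum]
      refine Finset.sum_congr rfl fun l _ => ?_
      rw [Finset.mul_sum]
      exact Finset.sum_congr rfl fun l' _ => by ring
    rw [h1, ← Finset.sum_mul, ← Finset.sum_mul, ← Finset.mul_sum]
    simp only [replicaDeriv, Fin.sum_univ_castSucc]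
    push_cast
    ring
  have h2 : ∑ k, ∑ l, ∑ l', d k * a k (x l) * a k (x l') = ∑ l, ∑ l', D (x l) (x l') := by
    rw [Finset.sum_comm]
    refine Finset.sum_congr rfl fun l _ => ?_
    rw [Finset.sum_comm]
    simp only [hD]
  have h3 : ∀ p, ∑ k, ∑ l, d k * a k (x l) * a k p = ∑ l, D (x l) p := by
    intro p
    rw [Finset.sum_comm]
    simp only [hD]
  change _ = (∑ l, ∑ l', if l < l' then G * D (x l) (x l') else 0) +
    ((1 - n) / 2 * ∑ l, G * D (x l) p) + (-((n : ℝ) + 1) / 2 * ∑ l, G * D (x l) r) +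
    (n : ℝ) * (n + 1) / 2 * (G * D p r)
  simp only [hk]
  rw [← Finset.mul_sum]
  simp only [Finset.sum_add_distrib, Finset.sum_sub_distrib, h2]
  simp only [← Finset.mul_sum, h3, hD]
  rw [sum_sum_eq_two_mul_sum_lt _ fun i j => hsymm _ _]
  have h4 : (∑ l : Fin n, ∑ l' : Fin n, if l < l' then G * D (x l) (x l') else 0) =
      G * ∑ l : Fin n, ∑ l' : Fin n, if l < l' then D (x l) (x l') else 0 := by
    simp only [Finset.mul_sum, mul_ite, mul_zero]
  rw [h4]
  simp only [hC, Finset.sum_const, Finset.card_univ, Fintype.card_fin, nsmul_eq_mul]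
  ring

lemma replicaAvg_add {n : ℕ} (F G : (Fin n → S) → ℝ) (y : S → ℝ) :
    replicaAvg (fun σs => F σs + G σs) y = replicaAvg F y + replicaAvg G y := by
  simp only [replicaAvg, add_mul, Finset.sum_add_distrib, add_div]

/-- The average of `F` against `D` evaluated at the replicas `i` and `j`. -/
def pairAvg {n : ℕ} (F : (Fin n → S) → ℝ) (D : S → S → ℝ) (y : S → ℝ) (i j : Fin (n + 2)) : ℝ :=
  replicaAvg (fun τ : Fin (n + 2) → S => F (fun l => τ l.castSucc.castSucc) * D (τ i) (τ j)) y

lemma pairAvg_last {n : ℕ} (F : (Fin n → S) → ℝ) (D : S → S → ℝ) (y : S → ℝ) (l : Fin n) :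
    pairAvg F D y l.castSucc.castSucc (Fin.last (n + 1)) =
      pairAvg F D y l.castSucc.castSucc (Fin.last n).castSucc := by
  unfold pairAvg
  rw [← replicaAvg_comp_perm (Equiv.swap (Fin.last n).castSucc (Fin.last (n + 1)))]
  have h : ∀ j : Fin n, Equiv.swap (Fin.last n).castSucc (Fin.last (n + 1)) j.castSucc.castSucc =
      j.castSucc.castSucc := fun j =>
    Equiv.swap_apply_of_ne_of_ne
      (fun h => (Fin.castSucc_lt_last j).ne (Fin.castSucc_injective _ h))
      (Fin.castSucc_lt_last _).ne
  simp only [Function.comp_apply, h, Equiv.swap_apply_right]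

lemma replicaAvg_sum_replicaDeriv {n : ℕ} (F : (Fin n → S) → ℝ) {a : K → S → ℝ} {d : K → ℝ}
    {D : S → S → ℝ} (hD : ∀ σ τ, ∑ k, d k * a k σ * a k τ = D σ τ) {C : ℝ} (hC : ∀ σ, D σ σ = C)
    (y : S → ℝ) :
    replicaAvg (fun τ => ∑ k, d k / 2 * replicaDeriv (a k) (replicaDeriv (a k) F) τ) y =
      (∑ l : Fin n, ∑ l' : Fin n,
          if l < l' then pairAvg F D y l.castSucc.castSucc l'.castSucc.castSucc else 0) -
        n * (∑ l : Fin n, pairAvg F D y l.castSucc.castSucc (Fin.last n).castSucc) +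
        (n : ℝ) * (n + 1) / 2 * pairAvg F D y (Fin.last n).castSucc (Fin.last (n + 1)) := by
  simp only [sum_replicaDeriv_replicaDeriv F hD hC, replicaAvg_add, replicaAvg_const_mul,
    replicaAvg_sum]
  have h : ∀ l l' : Fin n, replicaAvg (fun τ : Fin (n + 2) → S =>
      if l < l' then F (fun j => τ j.castSucc.castSucc) *
          D (τ l.castSucc.castSucc) (τ l'.castSucc.castSucc) else 0) y =
      if l < l' then pairAvg F D y l.castSucc.castSucc l'.castSucc.castSucc else 0 := by
    intro l l'
    split_ifs
    · rfl
    · simp [replicaAvg]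
  simp only [h]
  simp only [← pairAvg.eq_def, pairAvg_last]
  ring

end SecondDerivative

section TwoCoordinate

instance (N : ℕ) : IsProbabilityMeasure (gaussN N) := by
  unfold gaussN
  infer_instance

lemma spin_mul_self (b : Bool) : spin b * spin b = 1 := by
  cases b <;> simp [spin]

/-- The Gaussian variables involved in the two-coordinate interpolation. -/
abbrev InterpIdx (M : ℕ) := (Fin M ⊕ Fin M ⊕ Unit) ⊕ Bool

/-- The sample space of the disorder and of `z₁, z₂`. -/
abbrev Disorder (M : ℕ) := (Fin (M + 2) → Fin (M + 2) → ℝ) × (ℝ × ℝ)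

/-- The law of the disorder and of `z₁, z₂`. -/
def disorderLaw (M : ℕ) : Measure (Disorder M) :=
  (gaussN (M + 2)).prod ((gaussianReal 0 1).prod (gaussianReal 0 1))

instance (M : ℕ) : IsProbabilityMeasure (disorderLaw M) := by
  unfold disorderLaw
  infer_instance

/-- The pair of sites of an interpolated coupling. -/
def sitePair (M : ℕ) : Fin M ⊕ Fin M ⊕ Unit → Fin (M + 2) × Fin (M + 2)
  | .inl i => (i.castSucc.castSucc, Fin.last (M + 1))
  | .inr (.inl i) => (i.castSucc.castSucc, (Fin.last M).castSucc)
  | .inr (.inr _) => ((Fin.last M).castSucc, Fin.last (M + 1))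

lemma sitePair_injective (M : ℕ) : Function.Injective (sitePair M) := by
  have hlt : ∀ i : Fin M, (i : ℕ) ≠ M := fun i => i.isLt.ne
  have hlt' : ∀ i : Fin M, M ≠ (i : ℕ) := fun i => i.isLt.ne'
  rintro (i | i | i) (j | j | j) h <;> simp_all [sitePair, Fin.ext_iff]

/-- The value of an interpolated Gaussian variable. -/
def interpVar (M : ℕ) : InterpIdx M → Disorder M → ℝ
  | .inl k, ω => ω.1 (sitePair M k).1 (sitePair M k).2
  | .inr false, ω => ω.2.1
  | .inr true, ω => ω.2.2

/-- The coordinate direction of an interpolated Gaussian variable. -/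
def interpDir (M : ℕ) : InterpIdx M → Disorder M
  | .inl k => (Pi.single (sitePair M k).1 (Pi.single (sitePair M k).2 1), 0)
  | .inr false => (0, (1, 0))
  | .inr true => (0, (0, 1))

/-- The spin function multiplying an interpolated Gaussian variable. -/
def interpCoef (M : ℕ) (β q : ℝ) : InterpIdx M → Cfg (M + 2) → ℝ
  | .inl k, σ => β / Real.sqrt (M + 2) * (spin (σ (sitePair M k).1) * spin (σ (sitePair M k).2))
  | .inr false, σ => β * Real.sqrt q * spin (σ (Fin.last (M + 1)))
  | .inr true, σ => β * Real.sqrt q * spin (σ (Fin.last M).castSucc)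

/-- The standard deviation of an interpolated Gaussian variable. -/
def interpScale (M : ℕ) (u : ℝ) : InterpIdx M → ℝ
  | .inl _ => Real.sqrt u
  | .inr _ => Real.sqrt (1 - u)

/-- The derivative of `interpScale`. -/
def interpScaleDeriv (M : ℕ) (u : ℝ) : InterpIdx M → ℝ
  | .inl _ => 1 / (2 * Real.sqrt u)
  | .inr _ => -1 / (2 * Real.sqrt (1 - u))

/-- The derivative of the variance of an interpolated Gaussian variable. -/
def interpSign (M : ℕ) : InterpIdx M → ℝ
  | .inl _ => 1
  | .inr _ => -1

/-- The part of the Hamiltonian that is not interpolated. -/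
def bulkEnergy (M : ℕ) (β h : ℝ) (ω : Disorder M) (σ : Cfg (M + 2)) : ℝ :=
  (β / Real.sqrt (M + 2)) *
      ∑ i : Fin M, ∑ j : Fin M,
        (if i < j then
          ω.1 i.castSucc.castSucc j.castSucc.castSucc *
            spin (σ i.castSucc.castSucc) * spin (σ j.castSucc.castSucc) else 0) +
    h * ∑ i, spin (σ i)

/-- The derivative of the covariance of the interpolating Hamiltonian. -/
def interpCov (M : ℕ) (β q : ℝ) (σ τ : Cfg (M + 2)) : ℝ :=
  β ^ 2 * (spin (σ (Fin.last (M + 1))) * spin (τ (Fin.last (M + 1))) * (overlapEq M σ τ - q)) +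
    β ^ 2 * (spin (σ (Fin.last M).castSucc) * spin (τ (Fin.last M).castSucc) *
      (overlapEq M σ τ - q)) +
    β ^ 2 / (M + 2) * (spin (σ (Fin.last (M + 1))) * spin (τ (Fin.last (M + 1))) *
      spin (σ (Fin.last M).castSucc) * spin (τ (Fin.last M).castSucc))

lemma negHt2_eq_gaussEnergy (M : ℕ) (β h q u : ℝ) (ω : Disorder M) :
    negHt2 M β h q u ω.1 ω.2.1 ω.2.2 =
      gaussEnergy (interpVar M) (interpCoef M β q) (bulkEnergy M β h) (interpScale M u) ω := by
  ext σ
  simp only [negHt2, gaussEnergy, bulkEnergy, Fintype.sum_sum_type, Fintype.sum_bool,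
    Finset.univ_unique, Finset.sum_singleton, interpVar, interpCoef, interpScale, sitePair,
    Finset.mul_sum, mul_add]
  have h1 : ∀ i : Fin M, √u * ω.1 i.castSucc.castSucc (Fin.last (M + 1)) *
      (β / √(M + 2) * (spin (σ i.castSucc.castSucc) * spin (σ (Fin.last (M + 1))))) =
      √u * (spin (σ (Fin.last (M + 1))) * (β / √(M + 2)) *
        (ω.1 i.castSucc.castSucc (Fin.last (M + 1)) * spin (σ i.castSucc.castSucc))) :=
    fun i => by ring
  have h2 : ∀ i : Fin M, √u * ω.1 i.castSucc.castSucc (Fin.last M).castSucc *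
      (β / √(M + 2) * (spin (σ i.castSucc.castSucc) * spin (σ (Fin.last M).castSucc))) =
      √u * (spin (σ (Fin.last M).castSucc) * (β / √(M + 2)) *
        (ω.1 i.castSucc.castSucc (Fin.last M).castSucc * spin (σ i.castSucc.castSucc))) :=
    fun i => by ring
  simp only [h1, h2]
  ring

lemma sum_interpCoef (M : ℕ) (β : ℝ) {q : ℝ} (hq : 0 ≤ q) (σ τ : Cfg (M + 2)) :
    ∑ k, interpSign M k * interpCoef M β q k σ * interpCoef M β q k τ = interpCov M β q σ τ := by
  have hN : (0 : ℝ) < M + 2 := by positivity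
  have hs : (β / √(M + 2)) * (β / √(M + 2)) = β ^ 2 / (M + 2) := by
    rw [div_mul_div_comm, Real.mul_self_sqrt hN.le, sq]
  have hsum : ∀ c : Fin (M + 2), ∑ i : Fin M, 1 *
      (β / √(M + 2) * (spin (σ i.castSucc.castSucc) * spin (σ c))) *
      (β / √(M + 2) * (spin (τ i.castSucc.castSucc) * spin (τ c))) =
      β ^ 2 * (spin (σ c) * spin (τ c) * overlapEq M σ τ) := by
    intro c
    calc _ = ∑ i : Fin M, ((β / √(M + 2)) * (β / √(M + 2))) * (spin (σ c) * spin (τ c)) *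
          (spin (σ i.castSucc.castSucc) * spin (τ i.castSucc.castSucc)) :=
          Finset.sum_congr rfl fun i _ => by ring
      _ = _ := by
        rw [← Finset.mul_sum, hs, overlapEq]
        ring
  simp only [Fintype.sum_sum_type, Fintype.sum_bool, Finset.univ_unique, Finset.sum_singleton,
    interpCoef, interpSign, sitePair, hsum, interpCov]
  linear_combination (spin (σ (Fin.last M).castSucc) * spin (τ (Fin.last M).castSucc) *
    spin (σ (Fin.last (M + 1))) * spin (τ (Fin.last (M + 1)))) * hs -
    β ^ 2 * (spin (σ (Fin.last M).castSucc) * spin (τ (Fin.last M).castSucc) +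
    spin (σ (Fin.last (M + 1))) * spin (τ (Fin.last (M + 1)))) * Real.mul_self_sqrt hq

lemma interpCov_self (M : ℕ) (β q : ℝ) (σ : Cfg (M + 2)) :
    interpCov M β q σ σ = 2 * β ^ 2 * (M / (M + 2) - q) + β ^ 2 / (M + 2) := by
  simp only [interpCov, overlapEq, spin_mul_self, Finset.sum_const, Finset.card_univ,
    Fintype.card_fin, nsmul_eq_mul, mul_one, one_mul]
  ring

lemma gaussianIBP_interpVar (M : ℕ) (k : InterpIdx M) :
    GaussianIBP (disorderLaw M) (interpVar M k) (interpDir M k) := by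
  rcases k with k | _ | _
  · exact ((gaussianIBP_gaussianReal.pi _).pi _).prod_fst
  · exact gaussianIBP_gaussianReal.prod_fst.prod_snd
  · exact gaussianIBP_gaussianReal.prod_snd.prod_snd

lemma continuous_interpVar (M : ℕ) (k : InterpIdx M) : Continuous (interpVar M k) := by
  rcases k with k | _ | _ <;> unfold interpVar <;> fun_prop

lemma continuous_bulkEnergy (M : ℕ) (β h : ℝ) : Continuous (bulkEnergy M β h) := by
  refine continuous_pi fun σ => ?_
  unfold bulkEnergy
  refine (Continuous.const_mul (continuous_finsetSum _ fun i _ => continuous_finsetSum _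
    fun j _ => ?_) _).add continuous_const
  split_ifs <;> fun_prop

lemma interpVar_add_smul (M : ℕ) (j k : InterpIdx M) (ω : Disorder M) (r : ℝ) :
    interpVar M j (ω + r • interpDir M k) = interpVar M j ω + if j = k then r else 0 := by
  rcases j with j | _ | _ <;> rcases k with k | _ | _ <;>
    simp [interpVar, interpDir]
  rw [Pi.single_apply]
  by_cases h : j = k
  · simp [h]
  · have h' := (sitePair_injective M).ne h
    rw [Ne, Prod.ext_iff, not_and] at h'
    split_ifs with h1
    · simp [h' h1]
    · simp

lemma bulkEnergy_add_smul (M : ℕ) (β h : ℝ) (k : InterpIdx M) (ω : Disorder M) (r : ℝ) :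
    bulkEnergy M β h (ω + r • interpDir M k) = bulkEnergy M β h ω := by
  have hlast : ∀ j : Fin M, j.castSucc.castSucc ≠ Fin.last (M + 1) :=
    fun j => (Fin.castSucc_lt_last _).ne
  have hpen : ∀ j : Fin M, j.castSucc.castSucc ≠ (Fin.last M).castSucc :=
    fun j h => (Fin.castSucc_lt_last j).ne (Fin.castSucc_injective _ h)
  have hω : ∀ i j : Fin M, (ω + r • interpDir M k).1 i.castSucc.castSucc j.castSucc.castSucc =
      ω.1 i.castSucc.castSucc j.castSucc.castSucc := by
    intro i j
    rcases k with (k | k | k) | _ | _ <;>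
      simp [interpDir, sitePair, Pi.single_apply, ite_apply, hlast, hpen]
  ext σ
  simp only [bulkEnergy, hω]

lemma nuT2_eq_integral_replicaAvg (M : ℕ) (β h q u : ℝ) {n : ℕ}
    (F : (Fin n → Cfg (M + 2)) → ℝ) :
    nuT2 M β h q u F = ∫ ω, replicaAvg F (gaussEnergy (interpVar M) (interpCoef M β q)
      (bulkEnergy M β h) (interpScale M u) ω) ∂disorderLaw M := by
  simp only [nuT2, gibbsT2, negHt2_eq_gaussEnergy, Fintype.card_fin, replicaAvg, disorderLaw]

lemma hasDerivWithinAt_nuT2 (M : ℕ) (β h : ℝ) {q : ℝ} {n : ℕ}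
    (f : (Fin n → Cfg (M + 2)) → ℝ) {s : ℝ} (hs : s ∈ Set.Ico (0 : ℝ) 1) :
    HasDerivWithinAt (fun u => nuT2 M β h q u f)
      (∫ ω, replicaAvg (fun τ => ∑ k, interpSign M k / 2 *
          replicaDeriv (interpCoef M β q k) (replicaDeriv (interpCoef M β q k) f) τ)
        (gaussEnergy (interpVar M) (interpCoef M β q) (bulkEnergy M β h) (interpScale M s) ω)
        ∂disorderLaw M) (Set.Ico 0 1) s := by
  simp only [nuT2_eq_integral_replicaAvg]
  refine hasDerivWithinAt_integral_replicaAvg (c' := interpScaleDeriv M)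
    (gaussianIBP_interpVar M) (continuous_interpVar M) (continuous_bulkEnergy M β h)
    (interpVar_add_smul M) (bulkEnergy_add_smul M β h) ?_ ?_ ?_ ?_ f hs
  · rintro (k | k) u ⟨h0, h1⟩
    · exact Real.hasDerivAt_sqrt h0.ne'
    · exact ((hasDerivAt_id u).const_sub 1).sqrt (sub_pos.2 h1).ne'
  · rintro (k | k) u ⟨h0, h1⟩
    · have := (Real.sqrt_pos.2 h0).ne'
      unfold interpScaleDeriv
      exact ContinuousAt.continuousWithinAt (by fun_prop (disch := positivity))
    · have := (Real.sqrt_pos.2 (sub_pos.2 h1)).ne'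
      unfold interpScaleDeriv
      exact ContinuousAt.continuousWithinAt (by fun_prop (disch := positivity))
  · rintro (k | k) <;> unfold interpScale <;> fun_prop
  · rintro (k | k) u ⟨h0, h1⟩
    · have := (Real.sqrt_pos.2 h0).ne'
      simp only [interpScale, interpScaleDeriv, interpSign]
      field_simp
    · have := (Real.sqrt_pos.2 (sub_pos.2 h1)).ne'
      simp only [interpScale, interpScaleDeriv, interpSign]
      field_simp

lemma integral_pairAvg_interpCov (M : ℕ) (β h q s : ℝ) {n : ℕ}
    (f : (Fin n → Cfg (M + 2)) → ℝ) (i j : Fin (n + 2)) :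
    ∫ ω, pairAvg f (interpCov M β q) (gaussEnergy (interpVar M) (interpCoef M β q)
        (bulkEnergy M β h) (interpScale M s) ω) i j ∂disorderLaw M =
      β ^ 2 * dTerm M n β h q s f (Fin.last (M + 1)) i j +
        β ^ 2 * dTerm M n β h q s f (Fin.last M).castSucc i j +
        β ^ 2 / (M + 2) * dTerm2 M n β h q s f i j := by
  have hE := continuous_gaussEnergy (a := interpCoef M β q) (continuous_interpVar M)
    (continuous_bulkEnergy M β h) (interpScale M s)
  simp only [dTerm, dTerm2, nuT2_eq_integral_replicaAvg, ← integral_const_mul]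
  have hi := fun G : (Fin (n + 2) → Cfg (M + 2)) → ℝ =>
    integrable_replicaAvg (μ := disorderLaw M) G hE
  rw [← integral_add ((hi _).const_mul _) ((hi _).const_mul _),
    ← integral_add (((hi _).const_mul _).fun_add ((hi _).const_mul _)) ((hi _).const_mul _)]
  refine integral_congr_ae (ae_of_all _ fun ω => ?_)
  simp only [pairAvg, ← replicaAvg_const_mul, ← replicaAvg_add]
  congr 1
  ext τ
  simp only [interpCov, show ∀ l : Fin n, l.castLE (by omega : n ≤ n + 2) = l.castSucc.castSucc
    from fun _ => rfl]
  ring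

end TwoCoordinate

/-- Lemma 4: the derivative formula `ν_t′(f) = I + II + III` for the
two-coordinate interpolation, for `0 ≤ t < 1`. -/
theorem stmt7 :
    ∀ M : ℕ, ∀ β h q : ℝ, 0 < β → 0 ≤ h → 0 ≤ q → q < 1 →
      q = ∫ z, Real.tanh (β * z * Real.sqrt q + h) ^ 2 ∂ (gaussianReal 0 1 : Measure ℝ) →
      ∀ n : ℕ, 1 ≤ n → ∀ f : (Fin n → Cfg (M + 2)) → ℝ, ∀ s : ℝ, 0 ≤ s → s < 1 →
        HasDerivWithinAt (fun u => nuT2 M β h q u f)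
          ((β ^ 2 *
              (∑ l : Fin n, ∑ l' : Fin n,
                if l < l' then
                  dTerm M n β h q s f (Fin.last (M + 1)) (l.castLE (by omega))
                    (l'.castLE (by omega))
                else 0) -
            β ^ 2 * n *
              ∑ l : Fin n,
                dTerm M n β h q s f (Fin.last (M + 1)) (l.castLE (by omega)) ⟨n, by omega⟩ +
            β ^ 2 * ((n : ℝ) * (n + 1) / 2) *
              dTerm M n β h q s f (Fin.last (M + 1)) ⟨n, by omega⟩ ⟨n + 1, by omega⟩) +
          (β ^ 2 *
              (∑ l : Fin n, ∑ l' : Fin n,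
                if l < l' then
                  dTerm M n β h q s f (Fin.last M).castSucc (l.castLE (by omega))
                    (l'.castLE (by omega))
                else 0) -
            β ^ 2 * n *
              ∑ l : Fin n,
                dTerm M n β h q s f (Fin.last M).castSucc (l.castLE (by omega)) ⟨n, by omega⟩ +
            β ^ 2 * ((n : ℝ) * (n + 1) / 2) *
              dTerm M n β h q s f (Fin.last M).castSucc ⟨n, by omega⟩ ⟨n + 1, by omega⟩) +
          (β ^ 2 / (M + 2) *
            ((∑ l : Fin n, ∑ l' : Fin n,
                if l < l' then
                  dTerm2 M n β h q s f (l.castLE (by omega)) (l'.castLE (by omega))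
                else 0) -
              (n : ℝ) *
                ∑ l : Fin n, dTerm2 M n β h q s f (l.castLE (by omega)) ⟨n, by omega⟩ +
              ((n : ℝ) * (n + 1) / 2) *
                dTerm2 M n β h q s f ⟨n, by omega⟩ ⟨n + 1, by omega⟩)))
          (Set.Ico 0 1) s := by
  intro M β h q hβ _ hq0 _ _ n hn f s hs0 hs1
  have hE := continuous_gaussEnergy (a := interpCoef M β q) (continuous_interpVar M)
    (continuous_bulkEnergy M β h) (interpScale M s)
  have hi : ∀ i j, Integrable (fun ω => pairAvg f (interpCov M β q) (gaussEnergy (interpVar M)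
      (interpCoef M β q) (bulkEnergy M β h) (interpScale M s) ω) i j) (disorderLaw M) :=
    fun i j => integrable_replicaAvg _ hE
  have hi' : ∀ l l' : Fin n, Integrable (fun ω => if l < l' then pairAvg f (interpCov M β q)
      (gaussEnergy (interpVar M) (interpCoef M β q) (bulkEnergy M β h) (interpScale M s) ω)
      l.castSucc.castSucc l'.castSucc.castSucc else 0) (disorderLaw M) := by
    intro l l'
    split_ifs
    · exact hi _ _
    · exact integrable_zero _ _ _
  have hite : ∀ (p : Prop) [Decidable p] (F : Disorder M → ℝ),
      ∫ ω, (if p then F ω else 0) ∂disorderLaw M = if p then ∫ ω, F ω ∂disorderLaw M else 0 := by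
    intro p _ F
    split_ifs <;> simp
  refine (hasDerivWithinAt_nuT2 M β h f ⟨hs0, hs1⟩).congr_deriv ?_
  simp only [replicaAvg_sum_replicaDeriv f (sum_interpCoef M β hq0) (interpCov_self M β q)]
  rw [integral_add, integral_sub, integral_const_mul, integral_const_mul, integral_finsetSum,
    integral_finsetSum]
  · simp only [integral_finsetSum _ fun l' _ => hi' _ l', hite, integral_pairAvg_interpCov]
    have hsplit : ∀ A B C : Fin n → Fin n → ℝ,
        (∑ l, ∑ l', if l < l' then β ^ 2 * A l l' + β ^ 2 * B l l' + β ^ 2 / (M + 2) * C l l'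
          else 0) = β ^ 2 * (∑ l, ∑ l', if l < l' then A l l' else 0) +
          β ^ 2 * (∑ l, ∑ l', if l < l' then B l l' else 0) +
          β ^ 2 / (M + 2) * (∑ l, ∑ l', if l < l' then C l l' else 0) := by
      intro A B C
      simp only [Finset.mul_sum, ← Finset.sum_add_distrib]
      refine Finset.sum_congr rfl fun l _ => Finset.sum_congr rfl fun l' _ => ?_
      split_ifs <;> ring
    rw [hsplit]
    simp only [Finset.sum_add_distrib, ← Finset.mul_sum]
    simp only [show ∀ l : Fin n, l.castLE (by omega : n ≤ n + 2) = l.castSucc.castSucc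
      from fun _ => rfl, show (⟨n, by omega⟩ : Fin (n + 2)) = (Fin.last n).castSucc from rfl,
      show (⟨n + 1, by omega⟩ : Fin (n + 2)) = Fin.last (n + 1) from rfl]
    ring
  · exact fun l _ => hi _ _
  · exact fun l _ => integrable_finsetSum _ fun l' _ => hi' l l'
  · exact integrable_finsetSum _ fun l _ => integrable_finsetSum _ fun l' _ => hi' l l'
  · exact (integrable_finsetSum _ fun l _ => hi _ _).const_mul _
  · exact (integrable_finsetSum _ fun l _ => integrable_finsetSum _ fun l' _ => hi' l l').sub
      ((integrable_finsetSum _ fun l _ => hi _ _).const_mul _)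
  · exact (hi _ _).const_mul _

end
end

section
/- There exists β₀ > 0 such that for all β < β₀ the following holds for the two-coordinate interpolation: for every n ≥ 1 and m ≥ 0 there is a constant K depending only on n and m such that for every function f on Σ_N^n, |ν(f) − Σ_{j=0}^m ν₀₀^{(j)}(f)/j!| ≤ (K/N^{(m+1)/2})·ν(f²)^{1/2}, where ν₀₀^{(j)}(f) denotes the j-th derivative of t ↦ ν_t(f) evaluated at t = 0. -/
open MeasureTheory ProbabilityTheory Finset

noncomputable section

/-- The standard Gaussian measure on `κ → ℝ`. -/
def stdG (κ : Type) [Fintype κ] : Measure (κ → ℝ) := Measure.pi fun _ => gaussianReal 0 1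

instance (κ : Type) [Fintype κ] : IsProbabilityMeasure (stdG κ) := by
  unfold stdG; infer_instance

/-- Restriction of a power of a probability measure along an injection of the index sets. -/
lemma measurePreserving_pi_comp {ι ι' E : Type} [Fintype ι] [Fintype ι'] [MeasurableSpace E]
    (μ : Measure E) [IsProbabilityMeasure μ] (e : ι → ι') (he : Function.Injective e) :
    MeasurePreserving (fun x : ι' → E => x ∘ e) (Measure.pi fun _ => μ)
      (Measure.pi fun _ => μ) := by
  classical
  have hm : Measurable (fun x : ι' → E => x ∘ e) :=
    measurable_pi_lambda _ fun i => measurable_pi_apply (e i)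
  refine ⟨hm, (Measure.pi_eq fun s hs => ?_).symm⟩
  rw [Measure.map_apply hm (MeasurableSet.univ_pi hs)]
  have h1 : (fun x : ι' → E => x ∘ e) ⁻¹' Set.univ.pi s =
      Set.univ.pi fun j => if h : ∃ i, e i = j then s h.choose else Set.univ := by
    ext x
    simp only [Set.mem_preimage, Set.mem_pi, Set.mem_univ, true_imp_iff, Function.comp]
    constructor
    · intro h j
      by_cases hj : ∃ i, e i = j
      · rw [dif_pos hj]
        have := h hj.choose
        rwa [hj.choose_spec] at this
      · simp [hj]
    · intro h i
      have hj : ∃ i', e i' = e i := ⟨i, rfl⟩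
      have := h (e i)
      rw [dif_pos hj] at this
      rwa [he hj.choose_spec] at this
  rw [h1, Measure.pi_pi]
  rw [← Finset.prod_subset (Finset.subset_univ (Finset.univ.image e)), Finset.prod_image (by
    intro a _ b _ h; exact he h)]
  · refine Finset.prod_congr rfl fun i _ => ?_
    have hj : ∃ i', e i' = e i := ⟨i, rfl⟩
    rw [dif_pos hj, he hj.choose_spec]
  · intro j _ hj
    have : ¬ ∃ i, e i = j := by simpa using hj
    rw [dif_neg this, measure_univ]

/-- Resampling one coordinate of a Gaussian vector. -/
lemma measurePreserving_update {κ : Type} [Fintype κ] [DecidableEq κ] (k : κ) :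
    MeasurePreserving (fun p : (κ → ℝ) × ℝ => Function.update p.1 k p.2)
      ((stdG κ).prod (gaussianReal 0 1)) (stdG κ) := by
  have hm : Measurable (fun p : (κ → ℝ) × ℝ => Function.update p.1 k p.2) := by
    refine measurable_pi_lambda _ fun i => ?_
    by_cases h : i = k
    · subst h; simpa using measurable_snd
    · simpa [Function.update_of_ne h, Function.comp_def] using
        (measurable_pi_apply i).comp measurable_fst
  refine ⟨hm, (Measure.pi_eq fun s hs => ?_).symm⟩
  rw [Measure.map_apply hm (MeasurableSet.univ_pi hs)]
  have h1 : (fun p : (κ → ℝ) × ℝ => Function.update p.1 k p.2) ⁻¹' Set.univ.pi s =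
      (Set.univ.pi (Function.update s k Set.univ)) ×ˢ (s k) := by
    ext ⟨x, y⟩
    simp only [Set.mem_preimage, Set.mem_pi, Set.mem_univ, true_imp_iff, Set.mem_prod]
    constructor
    · intro h
      refine ⟨fun i => ?_, by simpa using h k⟩
      by_cases hi : i = k
      · subst hi; simp
      · simpa [Function.update_of_ne hi] using h i
    · rintro ⟨h, hk⟩ i
      by_cases hi : i = k
      · subst hi; simpa using hk
      · simpa [Function.update_of_ne hi] using h i
  rw [h1, Measure.prod_prod, stdG, Measure.pi_pi,
    ← Finset.mul_prod_erase univ _ (mem_univ k), ← Finset.mul_prod_erase univ _ (mem_univ k)]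
  simp only [Function.update_self, measure_univ, one_mul]
  rw [mul_comm]
  congr 1
  refine Finset.prod_congr rfl fun i hi => ?_
  rw [Function.update_of_ne (Finset.ne_of_mem_erase hi)]

/-- Gaussian integration by parts in one dimension. -/
lemma integral_mul_gaussianReal {φ φ' : ℝ → ℝ} {C C' : ℝ} (h : ∀ x, HasDerivAt φ (φ' x) x)
    (hφ : ∀ x, |φ x| ≤ C) (hφ' : ∀ x, |φ' x| ≤ C') :
    ∫ x, x * φ x ∂(gaussianReal 0 1) = ∫ x, φ' x ∂(gaussianReal 0 1) := by
  have hcont : Continuous φ := continuous_iff_continuousAt.2 fun x => (h x).continuousAt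
  have hmeas' : Measurable φ' := by
    have : φ' = deriv φ := by ext x; exact (h x).deriv.symm
    rw [this]; exact measurable_deriv φ
  have hg : Integrable (gaussianPDFReal 0 1) := integrable_gaussianPDFReal 0 1
  have hxg : Integrable (fun x => -x * gaussianPDFReal 0 1 x) := by
    have : gaussianPDFReal 0 1 = fun x => (√(2 * Real.pi))⁻¹ * Real.exp (-(1/2) * x ^ 2) := by
      ext x; simp [gaussianPDFReal]; left; ring
    rw [this]
    convert (integrable_mul_exp_neg_mul_sq (b := 1/2) (by norm_num)).const_mul
      (-(√(2 * Real.pi))⁻¹) using 2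
    ring
  have i1 : Integrable (fun x => φ x * (-x * gaussianPDFReal 0 1 x)) :=
    hxg.bdd_mul hcont.aestronglyMeasurable (Filter.Eventually.of_forall hφ)
  have i2 : Integrable (fun x => φ' x * gaussianPDFReal 0 1 x) :=
    hg.bdd_mul hmeas'.aestronglyMeasurable (Filter.Eventually.of_forall hφ')
  have i3 : Integrable (fun x => φ x * gaussianPDFReal 0 1 x) :=
    hg.bdd_mul hcont.aestronglyMeasurable (Filter.Eventually.of_forall hφ)
  have := integral_mul_deriv_eq_deriv_mul_of_integrable (u := φ) (u' := φ')
    (v := gaussianPDFReal 0 1) (v' := fun x => -x * gaussianPDFReal 0 1 x)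
    (fun x _ => h x) (fun x _ => hasDerivAt_gaussianPDFReal x) i1 i2 i3
  rw [integral_gaussianReal_eq_integral_smul (by norm_num),
    integral_gaussianReal_eq_integral_smul (by norm_num)]
  simp only [smul_eq_mul]
  rw [← neg_inj, ← integral_neg]
  calc _ = ∫ x, φ x * (-x * gaussianPDFReal 0 1 x) := by congr 1; ext x; ring
    _ = _ := by rw [this]; congr 2; ext x; ring

lemma integrable_abs_eval_stdG {κ : Type} [Fintype κ] (k : κ) :
    Integrable (fun g : κ → ℝ => |g k|) (stdG κ) := by
  have h : Integrable (fun x : ℝ => |x|) (gaussianReal 0 1) :=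
    ((memLp_id_gaussianReal (μ := 0) (v := 1) 1).integrable (by simp)).abs
  have hp : MeasurePreserving (Function.eval k) (stdG κ) (gaussianReal 0 1) :=
    measurePreserving_eval (fun _ : κ => gaussianReal 0 1) k
  exact (hp.integrable_comp h.aestronglyMeasurable).2 h

/-- Gaussian integration by parts for one coordinate of a Gaussian vector. -/
lemma integral_mul_stdG {κ : Type} [Fintype κ] [DecidableEq κ] (k : κ) {φ φ' : (κ → ℝ) → ℝ}
    {C C' : ℝ} (hc : Continuous φ) (hc' : Continuous φ')
    (h : ∀ g x, HasDerivAt (fun y => φ (Function.update g k y)) (φ' (Function.update g k x)) x)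
    (hφ : ∀ x, |φ x| ≤ C) (hφ' : ∀ x, |φ' x| ≤ C') :
    ∫ g, g k * φ g ∂(stdG κ) = ∫ g, φ' g ∂(stdG κ) := by
  have hp := measurePreserving_update k
  have i1 : Integrable (fun g : κ → ℝ => g k * φ g) (stdG κ) := by
    have : Integrable (fun g : κ → ℝ => g k) (stdG κ) :=
      (integrable_norm_iff (measurable_pi_apply k).aestronglyMeasurable).1
        (integrable_abs_eval_stdG k)
    exact this.mul_bdd hc.aestronglyMeasurable (Filter.Eventually.of_forall hφ)
  have i2 : Integrable φ' (stdG κ) :=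
    Integrable.of_bound hc'.aestronglyMeasurable C' (Filter.Eventually.of_forall hφ')
  have e1 := integral_map hp.aemeasurable (f := fun g : κ → ℝ => g k * φ g)
    (by rw [hp.map_eq]; exact i1.aestronglyMeasurable)
  have e2 := integral_map hp.aemeasurable (f := φ')
    (by rw [hp.map_eq]; exact i2.aestronglyMeasurable)
  rw [hp.map_eq] at e1 e2
  rw [e1, e2, integral_prod, integral_prod]
  · congr 1; ext g
    simp only [Function.update_self]
    exact integral_mul_gaussianReal (h g) (fun x => hφ _) (fun x => hφ' _)
  · exact (hp.integrable_comp i2.aestronglyMeasurable).2 i2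
  · exact (hp.integrable_comp i1.aestronglyMeasurable).2 i1

section GibbsAverage

variable {κ S : Type} [Fintype κ] [Fintype S] (a : κ → S → ℝ) (b : S → ℝ)

/-- A Hamiltonian linear in the parameters `x`. -/
def linH (x : κ → ℝ) (σ : S) : ℝ := ∑ k, x k * a k σ + b σ

/-- The Gibbs average associated with `linH`. -/
def gav (x : κ → ℝ) (f : S → ℝ) : ℝ :=
  (∑ σ, f σ * Real.exp (linH a b x σ)) / ∑ σ, Real.exp (linH a b x σ)

/-- The expected Gibbs average when the parameters are independent centered Gaussians
with variances `v`. -/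
def gev (v : κ → ℝ) (f : S → ℝ) : ℝ :=
  ∫ g, gav a b (fun k => √(v k) * g k) f ∂ stdG κ

lemma partition_pos [Nonempty S] (x : κ → ℝ) : 0 < ∑ σ, Real.exp (linH a b x σ) :=
  Finset.sum_pos (fun _ _ => Real.exp_pos _) univ_nonempty

lemma gav_mono (x : κ → ℝ) {f f' : S → ℝ} (h : ∀ σ, f σ ≤ f' σ) :
    gav a b x f ≤ gav a b x f' := by
  unfold gav
  gcongr with σ
  exact h σ

lemma gav_const [Nonempty S] (x : κ → ℝ) (c : ℝ) : gav a b x (fun _ => c) = c := by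
  unfold gav
  rw [← Finset.mul_sum, mul_div_assoc, div_self (partition_pos a b x).ne', mul_one]

lemma gav_add (x : κ → ℝ) (f f' : S → ℝ) :
    gav a b x (fun σ => f σ + f' σ) = gav a b x f + gav a b x f' := by
  simp only [gav, add_mul, Finset.sum_add_distrib, add_div]

lemma gav_const_mul (x : κ → ℝ) (c : ℝ) (f : S → ℝ) :
    gav a b x (fun σ => c * f σ) = c * gav a b x f := by
  simp only [gav, mul_assoc, ← Finset.mul_sum, mul_div_assoc]

lemma gav_sum {ι : Type} (s : Finset ι) (x : κ → ℝ) (f : ι → S → ℝ) :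
    gav a b x (fun σ => ∑ i ∈ s, f i σ) = ∑ i ∈ s, gav a b x (f i) := by
  simp only [gav, Finset.sum_mul, ← Finset.sum_div]
  rw [Finset.sum_comm]

lemma abs_gav_le [Nonempty S] (x : κ → ℝ) {f : S → ℝ} {C : ℝ} (h : ∀ σ, |f σ| ≤ C) :
    |gav a b x f| ≤ C := by
  rw [abs_le]
  constructor
  · simpa [gav_const] using gav_mono a b x (f := fun _ => -C) (fun σ => (abs_le.1 (h σ)).1)
  · simpa [gav_const] using gav_mono a b x (f' := fun _ => C) (fun σ => (abs_le.1 (h σ)).2)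

lemma continuous_gav [Nonempty S] (f : S → ℝ) : Continuous fun x => gav a b x f := by
  unfold gav
  refine Continuous.div ?_ ?_ fun x => (partition_pos a b x).ne' <;>
  · unfold linH; fun_prop

lemma gav_hasDerivAt [Nonempty S] {x : ℝ → κ → ℝ} {x' : κ → ℝ} {s : ℝ}
    (hx : ∀ k, HasDerivAt (fun s => x s k) (x' k) s) (f : S → ℝ) :
    HasDerivAt (fun s => gav a b (x s) f)
      (∑ k, x' k * (gav a b (x s) (fun σ => f σ * a k σ) -
        gav a b (x s) f * gav a b (x s) (a k))) s := by
  have hH : ∀ σ, HasDerivAt (fun s => linH a b (x s) σ) (∑ k, x' k * a k σ) s := fun σ => by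
    unfold linH
    exact (HasDerivAt.fun_sum fun k _ => (hx k).mul_const (a k σ)).add_const _
  have hZ : HasDerivAt (fun s => ∑ σ, Real.exp (linH a b (x s) σ))
      (∑ σ, Real.exp (linH a b (x s) σ) * ∑ k, x' k * a k σ) s :=
    HasDerivAt.fun_sum fun σ _ => (hH σ).exp
  have hN : HasDerivAt (fun s => ∑ σ, f σ * Real.exp (linH a b (x s) σ))
      (∑ σ, f σ * (Real.exp (linH a b (x s) σ) * ∑ k, x' k * a k σ)) s :=
    HasDerivAt.fun_sum fun σ _ => ((hH σ).exp).const_mul _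
  have hZ0 := (partition_pos a b (x s)).ne'
  refine (hN.div hZ hZ0).congr_deriv ?_
  have e1 : ∑ σ, f σ * (Real.exp (linH a b (x s) σ) * ∑ k, x' k * a k σ) =
      ∑ k, x' k * ∑ σ, f σ * a k σ * Real.exp (linH a b (x s) σ) := by
    simp only [Finset.mul_sum]
    rw [Finset.sum_comm]
    refine Finset.sum_congr rfl fun k _ => Finset.sum_congr rfl fun σ _ => by ring
  have e2 : ∑ σ, (Real.exp (linH a b (x s) σ) * ∑ k, x' k * a k σ) =
      ∑ k, x' k * ∑ σ, a k σ * Real.exp (linH a b (x s) σ) := by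
    simp only [Finset.mul_sum]
    rw [Finset.sum_comm]
    refine Finset.sum_congr rfl fun k _ => Finset.sum_congr rfl fun σ _ => by ring
  rw [e1, e2]
  unfold gav
  set Z := ∑ σ, Real.exp (linH a b (x s) σ)
  set A := ∑ σ, f σ * Real.exp (linH a b (x s) σ)
  rw [Finset.sum_mul, Finset.mul_sum, ← Finset.sum_sub_distrib, Finset.sum_div]
  refine Finset.sum_congr rfl fun k _ => ?_
  field_simp

/-- The integrand produced by differentiating twice in the direction `k`. -/
def gavSecond (x : κ → ℝ) (f : S → ℝ) (k : κ) : ℝ :=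
  gav a b x (fun σ => f σ * a k σ * a k σ) - 2 * gav a b x (fun σ => f σ * a k σ) * gav a b x (a k)
    - gav a b x f * gav a b x (fun σ => a k σ * a k σ) + 2 * gav a b x f * gav a b x (a k) ^ 2

lemma exists_abs_le (f : S → ℝ) : ∃ C, 0 ≤ C ∧ ∀ σ, |f σ| ≤ C :=
  ⟨∑ σ, |f σ|, Finset.sum_nonneg fun _ _ => abs_nonneg _, fun σ =>
    Finset.single_le_sum (f := fun σ => |f σ|) (fun _ _ => abs_nonneg _) (mem_univ σ)⟩

lemma exists_abs_gav_le [Nonempty S] (f : S → ℝ) : ∃ C, 0 ≤ C ∧ ∀ x, |gav a b x f| ≤ C := by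
  obtain ⟨C, h0, h⟩ := exists_abs_le f
  exact ⟨C, h0, fun x => abs_gav_le a b x h⟩

lemma integrable_gav [Nonempty S] (v : κ → ℝ) (f : S → ℝ) :
    Integrable (fun g => gav a b (fun k => √(v k) * g k) f) (stdG κ) := by
  obtain ⟨C, _, h⟩ := exists_abs_gav_le a b f
  refine Integrable.of_bound (Continuous.aestronglyMeasurable ?_) C
    (Filter.Eventually.of_forall fun g => h _)
  exact (continuous_gav a b f).comp (by fun_prop)

lemma gav_byParts [Nonempty S] (v : κ → ℝ) (f : S → ℝ) (k : κ) :
    ∫ g, g k * (gav a b (fun k => √(v k) * g k) (fun σ => f σ * a k σ) -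
        gav a b (fun k => √(v k) * g k) f * gav a b (fun k => √(v k) * g k) (a k)) ∂ stdG κ =
      √(v k) * ∫ g, gavSecond a b (fun k => √(v k) * g k) f k ∂ stdG κ := by
  classical
  obtain ⟨C1, h1, H1⟩ := exists_abs_gav_le a b f
  obtain ⟨C2, h2, H2⟩ := exists_abs_gav_le a b (fun σ => f σ * a k σ)
  obtain ⟨C3, h3, H3⟩ := exists_abs_gav_le a b (a k)
  obtain ⟨C4, h4, H4⟩ := exists_abs_gav_le a b (fun σ => f σ * a k σ * a k σ)
  obtain ⟨C5, h5, H5⟩ := exists_abs_gav_le a b (fun σ => a k σ * a k σ)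
  have hs : Continuous fun g : κ → ℝ => fun k => √(v k) * g k := by fun_prop
  have hc : ∀ f : S → ℝ, Continuous fun g : κ → ℝ => gav a b (fun k => √(v k) * g k) f :=
    fun f => (continuous_gav a b f).comp hs
  rw [← integral_const_mul]
  refine integral_mul_stdG k (C := C2 + C1 * C3)
    (C' := √(v k) * (C4 + 2 * C2 * C3 + C1 * C5 + 2 * C1 * C3 ^ 2)) ?_ ?_ ?_ ?_ ?_
  · exact (hc _).sub ((hc _).mul (hc _))
  · unfold gavSecond
    have := hc f; have := hc (a k); have := hc (fun σ => f σ * a k σ)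
    have := hc (fun σ => f σ * a k σ * a k σ); have := hc (fun σ => a k σ * a k σ)
    fun_prop
  · intro g x
    have hx : ∀ j, HasDerivAt (fun y => √(v j) * Function.update g k y j)
        (if j = k then √(v k) else 0) x := by
      intro j
      by_cases hj : j = k
      · subst hj
        simpa using (hasDerivAt_id x).const_mul (√(v j))
      · simpa [hj, Function.update_of_ne hj] using hasDerivAt_const x (√(v j) * g j)
    have d := fun f' => gav_hasDerivAt a b (x := fun y j => √(v j) * Function.update g k y j) hx f'
    refine ((d (fun σ => f σ * a k σ)).sub ((d f).mul (d (a k)))).congr_deriv ?_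
    simp only [ite_mul, zero_mul, Finset.sum_ite_eq', mem_univ, if_true, gavSecond]
    ring
  · intro x
    refine (abs_sub _ _).trans ?_
    rw [abs_mul]
    gcongr <;> apply_assumption
  · intro x
    rw [abs_mul, abs_of_nonneg (Real.sqrt_nonneg _)]
    unfold gavSecond
    refine mul_le_mul_of_nonneg_left ?_ (Real.sqrt_nonneg _)
    refine (abs_add_le _ _).trans (add_le_add ((abs_sub _ _).trans (add_le_add
      ((abs_sub _ _).trans (add_le_add (H4 _) ?_)) ?_)) ?_)
    · rw [abs_mul, abs_mul, abs_two]
      gcongr <;> apply_assumption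
    · rw [abs_mul]
      gcongr <;> apply_assumption
    · rw [abs_mul, abs_mul, abs_two, abs_pow]
      gcongr <;> apply_assumption

end GibbsAverage

section Interpolation

variable {κ S : Type} [Fintype κ] [Fintype S] (a : κ → S → ℝ) (b : S → ℝ)

lemma continuous_gev [Nonempty S] {v : ℝ → κ → ℝ} (hv : Continuous v) (f : S → ℝ) :
    Continuous fun s => gev a b (v s) f := by
  obtain ⟨C, _, h⟩ := exists_abs_gav_le a b f
  unfold gev
  refine continuous_of_dominated (bound := fun _ => C) (fun s => ?_) (fun s => ?_)
    (integrable_const _) ?_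
  · exact (integrable_gav a b (v s) f).aestronglyMeasurable
  · exact Filter.Eventually.of_forall fun g => h _
  · refine Filter.Eventually.of_forall fun g => (continuous_gav a b f).comp ?_
    fun_prop

/-- The Gaussian interpolation formula, for variances `p + s e`. -/
lemma gev_hasDerivAt [Nonempty S] (p e : κ → ℝ) {s : ℝ}
    (hpos : ∀ k, e k = 0 ∨ 0 < p k + s * e k) (f : S → ℝ) :
    HasDerivAt (fun s => gev a b (fun k => p k + s * e k) f)
      (∫ g, 1 / 2 * ∑ k, e k * gavSecond a b (fun k => √(p k + s * e k) * g k) f k ∂ stdG κ) s := by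
  set D : ℝ → (κ → ℝ) → κ → ℝ := fun s g k =>
    gav a b (fun k => √(p k + s * e k) * g k) (fun σ => f σ * a k σ) -
      gav a b (fun k => √(p k + s * e k) * g k) f *
        gav a b (fun k => √(p k + s * e k) * g k) (a k) with hD
  set c : ℝ → κ → ℝ := fun s k => e k / (2 * √(p k + s * e k)) with hcdef
  set F' : ℝ → (κ → ℝ) → ℝ := fun s g => ∑ k, (c s k * g k) * D s g k with hF'
  have hopen : ∀ k, ∀ᶠ u in nhds s, e k = 0 ∨ 0 < p k + u * e k := by
    intro k
    rcases hpos k with h | h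
    · exact Filter.Eventually.of_forall fun _ => Or.inl h
    · have : Continuous fun u => p k + u * e k := by fun_prop
      exact (this.continuousAt.eventually (lt_mem_nhds h)).mono fun u hu => Or.inr hu
  have hcc : ∀ k, ContinuousAt (fun u => |c u k|) s := by
    intro k
    rcases hpos k with h | h
    · simpa [hcdef, h] using continuousAt_const
    · refine ContinuousAt.abs (ContinuousAt.div continuousAt_const ?_ ?_)
      · exact Continuous.continuousAt (by fun_prop)
      · have := Real.sqrt_pos.2 h
        positivity
  have hcb : ∀ k, ∀ᶠ u in nhds s, |c u k| ≤ |c s k| + 1 := fun k =>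
    ((hcc k).eventually (gt_mem_nhds (lt_add_one |c s k|))).mono fun u hu => hu.le
  have hDb : ∃ C, 0 ≤ C ∧ ∀ u g k, |D u g k| ≤ C := by
    obtain ⟨C1, h1, H1⟩ := exists_abs_gav_le a b f
    choose C2 h2 H2 using fun k => exists_abs_gav_le a b (fun σ => f σ * a k σ)
    choose C3 h3 H3 using fun k => exists_abs_gav_le a b (a k)
    refine ⟨∑ k, (C2 k + C1 * C3 k), Finset.sum_nonneg fun k _ =>
      add_nonneg (h2 k) (mul_nonneg h1 (h3 k)), fun u g k => ?_⟩
    refine le_trans ?_ (Finset.single_le_sum (f := fun k => C2 k + C1 * C3 k)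
      (fun k _ => add_nonneg (h2 k) (mul_nonneg h1 (h3 k))) (mem_univ k))
    refine (abs_sub _ _).trans (add_le_add (H2 k _) ?_)
    rw [abs_mul]
    exact mul_le_mul (H1 _) (H3 k _) (abs_nonneg _) h1
  obtain ⟨C, hC0, hC⟩ := hDb
  have hset : {u | (∀ k, e k = 0 ∨ 0 < p k + u * e k) ∧ ∀ k, |c u k| ≤ |c s k| + 1} ∈ nhds s :=
    ((Filter.eventually_all.2 hopen).and (Filter.eventually_all.2 hcb))
  have hsc : ∀ u, Continuous fun g : κ → ℝ => fun k => √(p k + u * e k) * g k :=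
    fun u => by fun_prop
  have hDc : ∀ u k, Continuous fun g => D u g k := fun u k =>
    ((continuous_gav a b _).comp (hsc u)).sub
      (((continuous_gav a b _).comp (hsc u)).mul ((continuous_gav a b _).comp (hsc u)))
  have hF'c : Continuous (F' s) := by
    refine continuous_finsetSum _ fun k _ => Continuous.mul (by fun_prop) (hDc s k)
  have key := hasDerivAt_integral_of_dominated_loc_of_deriv_le (μ := stdG κ) (x₀ := s)
    (F := fun u g => gav a b (fun k => √(p k + u * e k) * g k) f) (F' := F')
    (bound := fun g => ∑ k, (|c s k| + 1) * |g k| * C) hset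
    (Filter.Eventually.of_forall fun u =>
      (integrable_gav a b (fun k => p k + u * e k) f).aestronglyMeasurable)
    (integrable_gav a b (fun k => p k + s * e k) f) hF'c.aestronglyMeasurable
    (Filter.Eventually.of_forall fun g u hu => by
      refine (Finset.abs_sum_le_sum_abs _ _).trans (Finset.sum_le_sum fun k _ => ?_)
      rw [abs_mul, abs_mul]
      gcongr
      · exact hu.2 k
      · exact hC _ _ _)
    (integrable_finsetSum _ fun k _ => ((integrable_abs_eval_stdG k).const_mul _).mul_const _)
    (Filter.Eventually.of_forall fun g u hu => by
      refine gav_hasDerivAt a b (x := fun u k => √(p k + u * e k) * g k) (fun k => ?_) f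
      refine HasDerivAt.mul_const ?_ _
      rcases hu.1 k with h | h
      · simpa [hcdef, h] using hasDerivAt_const u (√(p k))
      · have h1 : HasDerivAt (fun u => p k + u * e k) (e k) u := by
          simpa using ((hasDerivAt_id u).mul_const (e k)).const_add (p k)
        exact h1.sqrt h.ne')
  refine key.2.congr_deriv ?_
  have hint : ∀ k, Integrable (fun g => g k * D s g k) (stdG κ) := by
    intro k
    have : Integrable (fun g : κ → ℝ => g k) (stdG κ) :=
      (integrable_norm_iff (measurable_pi_apply k).aestronglyMeasurable).1
        (integrable_abs_eval_stdG k)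
    exact this.mul_bdd (hDc s k).aestronglyMeasurable
      (Filter.Eventually.of_forall fun g => hC s g k)
  have hsec : ∀ k, Integrable (fun g => gavSecond a b (fun k => √(p k + s * e k) * g k) f k)
      (stdG κ) := by
    intro k
    have I := fun f : S → ℝ => integrable_gav a b (fun k => p k + s * e k) f
    have B := fun f : S → ℝ => exists_abs_gav_le a b f
    have IM : ∀ f f' : S → ℝ, Integrable (fun g => gav a b (fun k => √(p k + s * e k) * g k) f *
        gav a b (fun k => √(p k + s * e k) * g k) f') (stdG κ) := fun f f' => by
      obtain ⟨C', _, H⟩ := B f'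
      exact (I f).mul_bdd (I f').aestronglyMeasurable (Filter.Eventually.of_forall fun g => H _)
    have IM3 : Integrable (fun g => gav a b (fun k => √(p k + s * e k) * g k) f *
        gav a b (fun k => √(p k + s * e k) * g k) (a k) *
        gav a b (fun k => √(p k + s * e k) * g k) (a k)) (stdG κ) := by
      obtain ⟨C', _, H⟩ := B (a k)
      exact (IM f (a k)).mul_bdd (I (a k)).aestronglyMeasurable
        (Filter.Eventually.of_forall fun g => H _)
    have := (((I (fun σ => f σ * a k σ * a k σ)).sub
      ((IM (fun σ => f σ * a k σ) (a k)).const_mul 2)).sub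
      (IM f (fun σ => a k σ * a k σ))).add (IM3.const_mul 2)
    refine this.congr (Filter.Eventually.of_forall fun g => ?_)
    simp only [gavSecond, Pi.add_apply, Pi.sub_apply]
    ring
  calc ∫ g, F' s g ∂stdG κ = ∑ k, c s k * ∫ g, g k * D s g k ∂stdG κ := by
        rw [hF']
        simp only [mul_assoc]
        rw [integral_finsetSum _ fun k _ => (hint k).const_mul _]
        simp only [integral_const_mul]
    _ = ∑ k, 1 / 2 * (e k *
          ∫ g, gavSecond a b (fun k => √(p k + s * e k) * g k) f k ∂stdG κ) := by
        refine Finset.sum_congr rfl fun k _ => ?_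
        rw [gav_byParts a b (fun k => p k + s * e k) f k]
        rcases hpos k with h | h
        · simp [hcdef, h]
        · have := Real.sqrt_pos.2 h
          simp only [hcdef]
          generalize √(p k + s * e k) = r at this ⊢
          field_simp
    _ = _ := by
        rw [integral_const_mul, integral_finsetSum _ fun k _ => (hsec k).const_mul _]
        simp only [integral_const_mul, Finset.mul_sum]

/-- Extension of a derivative from the open unit interval to the closed one. -/
lemma hasDerivWithinAt_Icc_of_Ioo {F G : ℝ → ℝ} (hF : Continuous F) (hG : Continuous G)
    (h : ∀ s ∈ Set.Ioo (0 : ℝ) 1, HasDerivAt F (G s) s) :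
    ∀ s ∈ Set.Icc (0 : ℝ) 1, HasDerivWithinAt F (G s) (Set.Icc 0 1) s := by
  have hd : DifferentiableOn ℝ F (Set.Ioo 0 1) := fun s hs =>
    (h s hs).differentiableAt.differentiableWithinAt
  rintro s ⟨h0, h1⟩
  rcases h0.eq_or_lt with rfl | h0
  · refine (hasDerivWithinAt_Ici_of_tendsto_deriv hd hF.continuousWithinAt
      (Ioo_mem_nhdsGT one_pos) ?_).mono Set.Icc_subset_Ici_self
    refine (hG.continuousWithinAt (s := Set.Ioi 0) (x := 0)).tendsto.congr' ?_
    filter_upwards [Ioo_mem_nhdsGT (one_pos : (0 : ℝ) < 1)] with u hu using (h u hu).deriv.symm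
  rcases h1.eq_or_lt with rfl | h1
  · refine (hasDerivWithinAt_Iic_of_tendsto_deriv hd hF.continuousWithinAt
      (Ioo_mem_nhdsLT one_pos) ?_).mono Set.Icc_subset_Iic_self
    refine (hG.continuousWithinAt (s := Set.Iio 1) (x := 1)).tendsto.congr' ?_
    filter_upwards [Ioo_mem_nhdsLT (one_pos : (0 : ℝ) < 1)] with u hu using (h u hu).deriv.symm
  exact (h s ⟨h0, h1⟩).hasDerivWithinAt

end Interpolation

section Replicas

variable {κ C : Type} [Fintype κ] (a : κ → C → ℝ) (b : C → ℝ)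

/-- The coefficients of the replicated system. -/
def repA (ι : Type) [Fintype ι] (k : κ) (σ : ι → C) : ℝ := ∑ l, a k (σ l)

/-- The external field of the replicated system. -/
def repB (ι : Type) [Fintype ι] (σ : ι → C) : ℝ := ∑ l, b (σ l)

lemma linH_rep {ι : Type} [Fintype ι] (x : κ → ℝ) (σ : ι → C) :
    linH (repA a ι) (repB b ι) x σ = ∑ l, linH a b x (σ l) := by
  simp only [linH, repA, repB, Finset.sum_add_distrib, Finset.mul_sum]
  rw [Finset.sum_comm]

/-- The covariance variation associated with the rates `e`. -/
def covRate (e : κ → ℝ) (σ τ : C) : ℝ := ∑ k, e k * (a k σ * a k τ)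

/-- The factor by which differentiation along the interpolation multiplies a function
of `ι`-indexed replicas; two further families of replicas are involved. -/
def derivFactor (e : κ → ℝ) (ι : Type) [Fintype ι] (σ : ι ⊕ (ι ⊕ ι) → C) : ℝ :=
  1 / 2 * ((∑ l, ∑ l', covRate a e (σ (.inl l)) (σ (.inl l')))
    - 2 * (∑ l, ∑ l', covRate a e (σ (.inl l)) (σ (.inr (.inl l'))))
    - (∑ l, ∑ l', covRate a e (σ (.inr (.inl l))) (σ (.inr (.inl l'))))
    + 2 * (∑ l, ∑ l', covRate a e (σ (.inr (.inl l))) (σ (.inr (.inr l')))))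

lemma sum_covRate {ι : Type} [Fintype ι] (e : κ → ℝ) (x y : ι → C) :
    ∑ l, ∑ l', covRate a e (x l) (y l') = ∑ k, e k * (repA a ι k x * repA a ι k y) := by
  simp only [covRate, repA, Finset.sum_mul_sum]
  simp only [Finset.mul_sum]
  rw [Finset.sum_congr rfl fun l _ => Finset.sum_comm, Finset.sum_comm]

variable [Fintype C]

/-- The Gibbs average of a function of `ι`-indexed replicas. -/
abbrev rav {ι : Type} [Fintype ι] [DecidableEq ι] (x : κ → ℝ) (f : (ι → C) → ℝ) : ℝ :=
  gav (repA a ι) (repB b ι) x f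

/-- The expected Gibbs average of a function of `ι`-indexed replicas. -/
abbrev rev {ι : Type} [Fintype ι] [DecidableEq ι] (v : κ → ℝ) (f : (ι → C) → ℝ) : ℝ :=
  gev (repA a ι) (repB b ι) v f

/-- The Gibbs weight of a single configuration. -/
def gibbsWeight (x : κ → ℝ) (σ : C) : ℝ :=
  Real.exp (linH a b x σ) / ∑ τ, Real.exp (linH a b x τ)

lemma sum_prod_replicas {ι : Type} [Fintype ι] [DecidableEq ι] (w : C → ℝ) :
    ∑ σ : ι → C, ∏ l, w (σ l) = (∑ c, w c) ^ Fintype.card ι := by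
  classical
  rw [← Fintype.piFinset_univ, ← Finset.prod_univ_sum]
  simp

lemma rav_eq {ι : Type} [Fintype ι] [DecidableEq ι] (x : κ → ℝ) (f : (ι → C) → ℝ) :
    rav a b x f = ∑ σ, f σ * ∏ l, gibbsWeight a b x (σ l) := by
  have h := sum_prod_replicas (ι := ι) fun c => Real.exp (linH a b x c)
  simp only [rav, gav, linH_rep, Real.exp_sum, gibbsWeight,
    Finset.prod_div_distrib, Finset.prod_const, Finset.card_univ]
  rw [h]
  simp only [Finset.sum_div, mul_div_assoc]

lemma sum_gibbsWeight [Nonempty C] (x : κ → ℝ) : ∑ σ, gibbsWeight a b x σ = 1 := by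
  simp only [gibbsWeight, ← Finset.sum_div]
  exact div_self (partition_pos a b x).ne'

lemma gibbsWeight_nonneg (x : κ → ℝ) (σ : C) : 0 ≤ gibbsWeight a b x σ :=
  div_nonneg (Real.exp_pos _).le (Finset.sum_nonneg fun _ _ => (Real.exp_pos _).le)

/-- Replicas indexed by disjoint sets are independent under the Gibbs measure. -/
lemma rav_sum_mul {ι ι' : Type} [Fintype ι] [DecidableEq ι] [Fintype ι'] [DecidableEq ι']
    (x : κ → ℝ) (f : (ι → C) → ℝ) (f' : (ι' → C) → ℝ) :
    rav a b x (fun σ : ι ⊕ ι' → C => f (σ ∘ Sum.inl) * f' (σ ∘ Sum.inr)) =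
      rav a b x f * rav a b x f' := by
  simp only [rav_eq]
  rw [Finset.sum_mul_sum, ← Fintype.sum_prod_type',
    ← (Equiv.sumArrowEquivProdArrow ι ι' C).sum_comp]
  refine Finset.sum_congr rfl fun σ _ => ?_
  simp only [Fintype.prod_sum_type, Equiv.sumArrowEquivProdArrow, Equiv.coe_fn_mk,
    Function.comp_apply]
  ring

/-- The Gibbs average only depends on the replicas that a function actually involves. -/
lemma rav_comp [Nonempty C] {ι ι' : Type} [Fintype ι] [DecidableEq ι] [Fintype ι']
    [DecidableEq ι'] (x : κ → ℝ) (e : ι → ι') (he : Function.Injective e) (f : (ι → C) → ℝ) :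
    rav a b x (fun σ : ι' → C => f (σ ∘ e)) = rav a b x f := by
  let _ : MeasurableSpace C := ⊤
  have : MeasurableSingletonClass C := ⟨fun _ => trivial⟩
  let μ : Measure C := ∑ c, ENNReal.ofReal (gibbsWeight a b x c) • Measure.dirac c
  have hμ : ∀ c, μ {c} = ENNReal.ofReal (gibbsWeight a b x c) := fun c => by
    classical
    simp [μ, Measure.finsetSum_apply, Set.indicator_apply]
  have : IsProbabilityMeasure μ := ⟨by
    simp only [μ, Measure.finsetSum_apply, Measure.smul_apply, measure_univ, smul_eq_mul, mul_one]
    rw [← ENNReal.ofReal_sum_of_nonneg fun c _ => gibbsWeight_nonneg a b x c, sum_gibbsWeight]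
    simp⟩
  have key : ∀ {ι : Type} [Fintype ι] [DecidableEq ι] (f : (ι → C) → ℝ),
      rav a b x f = ∫ σ, f σ ∂(Measure.pi fun _ : ι => μ) := by
    intro ι _ _ f
    rw [rav_eq, integral_fintype .of_finite]
    refine Finset.sum_congr rfl fun σ _ => ?_
    rw [Measure.real, Measure.pi_singleton]
    simp only [hμ]
    rw [ENNReal.toReal_prod, smul_eq_mul, mul_comm]
    simp only [ENNReal.toReal_ofReal (gibbsWeight_nonneg a b x _)]
  rw [key, key]
  have hp := measurePreserving_pi_comp μ e he
  rw [← hp.map_eq, integral_map hp.aemeasurable (measurable_of_finite _).aestronglyMeasurable]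

lemma rev_comp [Nonempty C] {ι ι' : Type} [Fintype ι] [DecidableEq ι] [Fintype ι']
    [DecidableEq ι'] (v : κ → ℝ) (e : ι → ι') (he : Function.Injective e) (f : (ι → C) → ℝ) :
    rev a b v (fun σ : ι' → C => f (σ ∘ e)) = rev a b v f := by
  unfold rev gev
  congr 1
  ext g
  exact rav_comp a b _ e he f

lemma rav_three {ι : Type} [Fintype ι] [DecidableEq ι] (x : κ → ℝ) (f f' f'' : (ι → C) → ℝ) :
    rav a b x (fun σ : ι ⊕ (ι ⊕ ι) → C => f (σ ∘ .inl) *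
      (f' ((σ ∘ .inr) ∘ .inl) * f'' ((σ ∘ .inr) ∘ .inr))) =
      rav a b x f * (rav a b x f' * rav a b x f'') := by
  rw [← rav_sum_mul a b x f' f'']
  exact rav_sum_mul a b x f (fun σ : ι ⊕ ι → C => f' (σ ∘ .inl) * f'' (σ ∘ .inr))

lemma rav_derivFactor [Nonempty C] {ι : Type} [Fintype ι] [DecidableEq ι] (e : κ → ℝ)
    (x : κ → ℝ) (f : (ι → C) → ℝ) :
    rav a b x (fun σ : ι ⊕ (ι ⊕ ι) → C => f (σ ∘ .inl) * derivFactor a e ι σ) =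
      1 / 2 * ∑ k, e k * gavSecond (repA a ι) (repB b ι) x f k := by
  have h1 : rav a b x (fun _ : ι → C => (1 : ℝ)) = 1 := gav_const _ _ _ _
  have expand : (fun σ : ι ⊕ (ι ⊕ ι) → C => f (σ ∘ .inl) * derivFactor a e ι σ) =
      fun σ => ∑ k, 1 / 2 * e k *
        ((f (σ ∘ .inl) * repA a ι k (σ ∘ .inl) * repA a ι k (σ ∘ .inl)) * (1 * 1) +
        (-2 * ((f (σ ∘ .inl) * repA a ι k (σ ∘ .inl)) * (repA a ι k ((σ ∘ .inr) ∘ .inl) * 1)) +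
        (-1 * (f (σ ∘ .inl) *
          ((repA a ι k ((σ ∘ .inr) ∘ .inl) * repA a ι k ((σ ∘ .inr) ∘ .inl)) * 1)) +
        2 * (f (σ ∘ .inl) *
          (repA a ι k ((σ ∘ .inr) ∘ .inl) * repA a ι k ((σ ∘ .inr) ∘ .inr)))))) := by
    ext σ
    have s1 := sum_covRate a e (fun l => σ (.inl l)) (fun l => σ (.inl l))
    have s2 := sum_covRate a e (fun l => σ (.inl l)) (fun l => σ (.inr (.inl l)))
    have s3 := sum_covRate a e (fun l => σ (.inr (.inl l))) (fun l => σ (.inr (.inl l)))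
    have s4 := sum_covRate a e (fun l => σ (.inr (.inl l))) (fun l => σ (.inr (.inr l)))
    rw [derivFactor, s1, s2, s3, s4]
    simp only [Finset.mul_sum, ← Finset.sum_sub_distrib, ← Finset.sum_add_distrib]
    refine Finset.sum_congr rfl fun k _ => ?_
    simp only [Function.comp_def]
    ring
  rw [expand]
  simp only [rav]
  rw [gav_sum, Finset.mul_sum]
  refine Finset.sum_congr rfl fun k _ => ?_
  rw [gav_const_mul, gav_add, gav_add, gav_add, gav_const_mul, gav_const_mul, gav_const_mul]
  have r1 := rav_three a b x (fun σ => f σ * repA a ι k σ * repA a ι k σ) (fun _ => 1) (fun _ => 1)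
  have r2 := rav_three a b x (fun σ => f σ * repA a ι k σ) (repA a ι k) (fun _ => 1)
  have r3 := rav_three a b x f (fun σ => repA a ι k σ * repA a ι k σ) (fun _ => 1)
  have r4 := rav_three a b x f (repA a ι k) (repA a ι k)
  rw [h1] at r1 r2 r3
  simp only [rav] at r1 r2 r3 r4
  rw [r1, r2, r3, r4, gavSecond]
  ring

lemma rev_hasDerivAt [Nonempty C] {ι : Type} [Fintype ι] [DecidableEq ι] (p e : κ → ℝ) {s : ℝ}
    (hpos : ∀ k, e k = 0 ∨ 0 < p k + s * e k) (f : (ι → C) → ℝ) :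
    HasDerivAt (fun s => rev a b (fun k => p k + s * e k) f)
      (rev a b (fun k => p k + s * e k)
        (fun σ : ι ⊕ (ι ⊕ ι) → C => f (σ ∘ .inl) * derivFactor a e ι σ)) s := by
  refine (gev_hasDerivAt (repA a ι) (repB b ι) p e hpos f).congr_deriv ?_
  rw [rev, gev]
  congr 1
  ext g
  exact (rav_derivFactor a b e _ f).symm

lemma rev_hasDerivWithinAt [Nonempty C] {ι : Type} [Fintype ι] [DecidableEq ι] (p e : κ → ℝ)
    (hpos : ∀ k, ∀ s ∈ Set.Ioo (0 : ℝ) 1, e k = 0 ∨ 0 < p k + s * e k) (f : (ι → C) → ℝ) :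
    ∀ s ∈ Set.Icc (0 : ℝ) 1, HasDerivWithinAt (fun s => rev a b (fun k => p k + s * e k) f)
      (rev a b (fun k => p k + s * e k)
        (fun σ : ι ⊕ (ι ⊕ ι) → C => f (σ ∘ .inl) * derivFactor a e ι σ)) (Set.Icc 0 1) s :=
  hasDerivWithinAt_Icc_of_Ioo (continuous_gev _ _ (by fun_prop) _)
    (continuous_gev _ _ (by fun_prop) _)
    fun s hs => rev_hasDerivAt a b p e (fun k => hpos k s hs) f

end Replicas

section Functional

variable {κ S : Type} [Fintype κ] [Fintype S] (a : κ → S → ℝ) (b : S → ℝ)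
  (v : κ → ℝ)

lemma gev_const_mul (c : ℝ) (f : S → ℝ) :
    gev a b v (fun σ => c * f σ) = c * gev a b v f := by
  simp only [gev, gav_const_mul, integral_const_mul]

variable [Nonempty S]

lemma gev_mono {f f' : S → ℝ} (h : ∀ σ, f σ ≤ f' σ) : gev a b v f ≤ gev a b v f' :=
  integral_mono (integrable_gav a b v f) (integrable_gav a b v f') fun _ => gav_mono a b _ h

lemma gev_add (f f' : S → ℝ) :
    gev a b v (fun σ => f σ + f' σ) = gev a b v f + gev a b v f' := by
  simp only [gev, gav_add]
  exact integral_add (integrable_gav a b v f) (integrable_gav a b v f')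

lemma gev_sum {ι : Type} (s : Finset ι) (f : ι → S → ℝ) :
    gev a b v (fun σ => ∑ i ∈ s, f i σ) = ∑ i ∈ s, gev a b v (f i) := by
  simp only [gev, gav_sum]
  exact integral_finsetSum _ fun i _ => integrable_gav a b v (f i)

lemma gev_const (c : ℝ) : gev a b v (fun _ => c) = c := by
  simp [gev, gav_const]

lemma gev_nonneg {f : S → ℝ} (h : ∀ σ, 0 ≤ f σ) : 0 ≤ gev a b v f := by
  simpa [gev_const] using gev_mono a b v h

/-- The mass that the averaged Gibbs measure gives to a configuration. -/
def gevMass (σ : S) : ℝ := by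
  classical exact gev a b v (fun τ => if τ = σ then 1 else 0)

lemma gev_eq_sum (f : S → ℝ) : gev a b v f = ∑ σ, f σ * gevMass a b v σ := by
  classical
  simp only [gevMass, ← gev_const_mul]
  rw [← gev_sum]
  congr 1
  ext σ
  simp

lemma gevMass_nonneg (σ : S) : 0 ≤ gevMass a b v σ := by
  classical
  exact gev_nonneg a b v fun τ => by split_ifs <;> norm_num

lemma abs_gev_mul_le (f f' : S → ℝ) :
    |gev a b v (fun σ => f σ * f' σ)| ≤
      √(gev a b v (fun σ => f σ ^ 2)) * √(gev a b v (fun σ => f' σ ^ 2)) := by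
  rw [← Real.sqrt_mul (gev_nonneg a b v fun σ => sq_nonneg _)]
  apply Real.abs_le_sqrt
  have h := Finset.sum_mul_sq_le_sq_mul_sq univ (fun σ => f σ * √(gevMass a b v σ))
    (fun σ => f' σ * √(gevMass a b v σ))
  have e : ∀ σ, √(gevMass a b v σ) ^ 2 = gevMass a b v σ := fun σ =>
    Real.sq_sqrt (gevMass_nonneg a b v σ)
  simp only [mul_pow, e] at h
  simp only [gev_eq_sum]
  have e' : ∑ σ, f σ * f' σ * gevMass a b v σ =
      ∑ σ, f σ * √(gevMass a b v σ) * (f' σ * √(gevMass a b v σ)) :=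
    Finset.sum_congr rfl fun σ _ => by
      conv_lhs => rw [← e σ]
      ring
  rw [e']
  exact h

end Functional

section Replicas

variable {κ C : Type} [Fintype κ] (a : κ → C → ℝ) (b : C → ℝ)

lemma abs_derivFactor_le {ι : Type} [Fintype ι] {e : κ → ℝ} {c : ℝ}
    (hc : ∀ σ τ, |covRate a e σ τ| ≤ c) (σ : ι ⊕ (ι ⊕ ι) → C) :
    |derivFactor a e ι σ| ≤ 3 * (Fintype.card ι : ℝ) ^ 2 * c := by
  have h : ∀ x y : ι → C, |∑ l, ∑ l', covRate a e (x l) (y l')| ≤ (Fintype.card ι : ℝ) ^ 2 * c := by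
    intro x y
    refine (Finset.abs_sum_le_sum_abs _ _).trans ((Finset.sum_le_sum fun l _ =>
      (Finset.abs_sum_le_sum_abs _ _).trans (Finset.sum_le_sum fun l' _ => hc _ _)).trans ?_)
    simp only [Finset.sum_const, Finset.card_univ, nsmul_eq_mul]
    exact le_of_eq (by ring)
  have s1 := abs_le.1 (h (fun l => σ (.inl l)) (fun l => σ (.inl l)))
  have s2 := abs_le.1 (h (fun l => σ (.inl l)) (fun l => σ (.inr (.inl l))))
  have s3 := abs_le.1 (h (fun l => σ (.inr (.inl l))) (fun l => σ (.inr (.inl l))))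
  have s4 := abs_le.1 (h (fun l => σ (.inr (.inl l))) (fun l => σ (.inr (.inr l))))
  rw [derivFactor, abs_le]
  constructor <;> linarith [s1.1, s1.2, s2.1, s2.2, s3.1, s3.2, s4.1, s4.2]

lemma abs_derivFactor_le_sum {ι : Type} [Fintype ι] [DecidableEq ι] {e : κ → ℝ}
    (hd : ∀ σ τ, covRate a e σ σ = covRate a e τ τ) (σ : ι ⊕ (ι ⊕ ι) → C) :
    |derivFactor a e ι σ| ≤
      ∑ r, ∑ r', if r = r' then 0 else |covRate a e (σ r) (σ r')| := by
  set u : ι ⊕ (ι ⊕ ι) → ι ⊕ (ι ⊕ ι) → ℝ := fun r r' =>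
    if r = r' then 0 else |covRate a e (σ r) (σ r')| with hu
  have hu0 : ∀ r r', 0 ≤ u r r' := fun r r' => by
    simp only [hu]; split_ifs <;> positivity
  have blk0 : ∀ i j : ι → ι ⊕ (ι ⊕ ι), 0 ≤ ∑ l, ∑ l', u (i l) (j l') := fun i j =>
    Finset.sum_nonneg fun l _ => Finset.sum_nonneg fun l' _ => hu0 _ _
  have off : ∀ i j : ι → ι ⊕ (ι ⊕ ι), (∀ l l', i l ≠ j l') →
      |∑ l, ∑ l', covRate a e (σ (i l)) (σ (j l'))| ≤ ∑ l, ∑ l', u (i l) (j l') := by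
    intro i j hij
    refine (Finset.abs_sum_le_sum_abs _ _).trans (Finset.sum_le_sum fun l _ =>
      (Finset.abs_sum_le_sum_abs _ _).trans (Finset.sum_le_sum fun l' _ => ?_))
    simp [hu, hij l l']
  have diag : ∀ i : ι → ι ⊕ (ι ⊕ ι), Function.Injective i →
      |∑ l, ∑ l', covRate a e (σ (i l)) (σ (i l')) - ∑ l, covRate a e (σ (i l)) (σ (i l))| ≤
        ∑ l, ∑ l', u (i l) (i l') := by
    intro i hi
    have : ∑ l, ∑ l', covRate a e (σ (i l)) (σ (i l')) - ∑ l, covRate a e (σ (i l)) (σ (i l)) =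
        ∑ l, ∑ l', if l = l' then 0 else covRate a e (σ (i l)) (σ (i l')) := by
      rw [← Finset.sum_sub_distrib]
      refine Finset.sum_congr rfl fun l _ => ?_
      rw [sub_eq_iff_eq_add, ← Finset.add_sum_erase univ _ (mem_univ l),
        ← Finset.add_sum_erase univ (fun l' => if l = l' then 0 else _) (mem_univ l), if_pos rfl,
        zero_add, add_comm]
      congr 1
      refine Finset.sum_congr rfl fun l' hl' => ?_
      rw [if_neg (Finset.ne_of_mem_erase hl').symm]
    rw [this]
    refine (Finset.abs_sum_le_sum_abs _ _).trans (Finset.sum_le_sum fun l _ =>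
      (Finset.abs_sum_le_sum_abs _ _).trans (Finset.sum_le_sum fun l' _ => ?_))
    by_cases h : l = l'
    · simp [hu, h]
    · simp [hu, h, hi.eq_iff]
  have eqd : ∑ l : ι, covRate a e (σ (.inl l)) (σ (.inl l)) =
      ∑ l : ι, covRate a e (σ (.inr (.inl l))) (σ (.inr (.inl l))) :=
    Finset.sum_congr rfl fun l _ => hd _ _
  have d1 := abs_le.1 (diag .inl Sum.inl_injective)
  have d2 := abs_le.1 (diag (fun l => .inr (.inl l)) (fun l l' h => by simpa using h))
  have o1 := abs_le.1 (off .inl (fun l => .inr (.inl l)) (by simp))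
  have o2 := abs_le.1 (off (fun l => .inr (.inl l)) (fun l => .inr (.inr l)) (by simp))
  have tot : ∑ r, ∑ r', u r r' =
      (∑ l : ι, ∑ l' : ι, u (.inl l) (.inl l')) +
      (∑ l : ι, ∑ l' : ι, u (.inl l) (.inr (.inl l'))) +
      (∑ l : ι, ∑ l' : ι, u (.inl l) (.inr (.inr l'))) +
      (∑ l : ι, ∑ l' : ι, u (.inr (.inl l)) (.inl l')) +
      (∑ l : ι, ∑ l' : ι, u (.inr (.inl l)) (.inr (.inl l'))) +
      (∑ l : ι, ∑ l' : ι, u (.inr (.inl l)) (.inr (.inr l'))) +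
      (∑ l : ι, ∑ l' : ι, u (.inr (.inr l)) (.inl l')) +
      (∑ l : ι, ∑ l' : ι, u (.inr (.inr l)) (.inr (.inl l'))) +
      (∑ l : ι, ∑ l' : ι, u (.inr (.inr l)) (.inr (.inr l'))) := by
    simp only [Fintype.sum_sum_type, Finset.sum_add_distrib]
    ring
  have b1 := blk0 .inl .inl
  have b2 := blk0 .inl (fun l => .inr (.inl l))
  have b3 := blk0 .inl (fun l => .inr (.inr l))
  have b4 := blk0 (fun l => .inr (.inl l)) .inl
  have b5 := blk0 (fun l => .inr (.inl l)) (fun l => .inr (.inl l))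
  have b6 := blk0 (fun l => .inr (.inl l)) (fun l => .inr (.inr l))
  have b7 := blk0 (fun l => .inr (.inr l)) .inl
  have b8 := blk0 (fun l => .inr (.inr l)) (fun l => .inr (.inl l))
  have b9 := blk0 (fun l => .inr (.inr l)) (fun l => .inr (.inr l))
  rw [tot, derivFactor, abs_le]
  constructor <;> linarith [d1.1, d1.2, d2.1, d2.2, o1.1, o1.2, o2.1, o2.2]

variable [Fintype C]

/-- Comparison of expectations of a nonnegative function along the interpolation. -/
lemma rev_le_exp_mul_rev_one [Nonempty C] {ι : Type} [Fintype ι] [DecidableEq ι] (p e : κ → ℝ)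
    (hpos : ∀ k, ∀ s ∈ Set.Ioo (0 : ℝ) 1, e k = 0 ∨ 0 < p k + s * e k) {c : ℝ} (hc0 : 0 ≤ c)
    (hc : ∀ σ τ, |covRate a e σ τ| ≤ c) {f : (ι → C) → ℝ} (hf : ∀ σ, 0 ≤ f σ)
    {s : ℝ} (hs : s ∈ Set.Icc (0 : ℝ) 1) :
    rev a b (fun k => p k + s * e k) f ≤
      Real.exp (3 * (Fintype.card ι : ℝ) ^ 2 * c) * rev a b (fun k => p k + 1 * e k) f := by
  set A : ℝ := 3 * (Fintype.card ι : ℝ) ^ 2 * c with hA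
  have hA0 : 0 ≤ A := by positivity
  set F : ℝ → ℝ := fun s => rev a b (fun k => p k + s * e k) f with hF
  have hFc : Continuous F := continuous_gev _ _ (by fun_prop) _
  have hmono : MonotoneOn (fun s => Real.exp (A * s) * F s) (Set.Icc 0 1) := by
    refine monotoneOn_of_deriv_nonneg (convex_Icc 0 1) (by fun_prop) ?_ ?_
    · rw [interior_Icc]
      intro u hu
      have := rev_hasDerivAt a b p e (fun k => hpos k u hu) f
      exact ((by fun_prop : DifferentiableAt ℝ (fun s => Real.exp (A * s)) u).mul
        this.differentiableAt).differentiableWithinAt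
    · rw [interior_Icc]
      intro u hu
      have h1 := rev_hasDerivAt a b p e (fun k => hpos k u hu) f
      have h2 : HasDerivAt (fun s => Real.exp (A * s)) (Real.exp (A * u) * A) u := by
        simpa using ((hasDerivAt_id u).const_mul A).exp
      have hd := (h2.mul h1).deriv
      have hF' : deriv (fun s => Real.exp (A * s) * F s) u = _ := hd
      rw [hF']
      have hb : -(A * F u) ≤ rev a b (fun k => p k + u * e k)
          (fun σ : ι ⊕ (ι ⊕ ι) → C => f (σ ∘ .inl) * derivFactor a e ι σ) := by
        have e1 : F u = rev a b (fun k => p k + u * e k)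
          (fun σ : ι ⊕ (ι ⊕ ι) → C => f (σ ∘ .inl)) :=
          (rev_comp a b _ Sum.inl Sum.inl_injective f).symm
        rw [e1, ← neg_mul, rev, ← gev_const_mul]
        refine gev_mono _ _ _ fun σ => ?_
        have := (abs_le.1 (abs_derivFactor_le a hc σ)).1
        nlinarith [hf (σ ∘ .inl)]
      have := Real.exp_pos (A * u)
      nlinarith
  have := hmono hs (Set.right_mem_Icc.2 zero_le_one) hs.2
  simp only [mul_one] at this
  have hFs : 0 ≤ F s := gev_nonneg _ _ _ hf
  calc F s = 1 * F s := (one_mul _).symm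
    _ ≤ Real.exp (A * s) * F s := by
        gcongr
        exact Real.one_le_exp (mul_nonneg hA0 hs.1)
    _ ≤ _ := this

end Replicas

section Iteration

lemma rev_derivFactor_pow_le {κ C : Type} [Fintype κ] [Fintype C] [Nonempty C] (a : κ → C → ℝ)
    (b : C → ℝ) {e v : κ → ℝ} (hd : ∀ σ τ, covRate a e σ σ = covRate a e τ τ) {k : ℕ} {D : ℝ}
    (hD : rev a b v (fun σ : Fin 2 → C => covRate a e (σ 0) (σ 1) ^ (2 * (k + 1))) ≤ D)
    (ι : Type) [Fintype ι] [DecidableEq ι] :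
    rev a b v (fun σ => derivFactor a e ι σ ^ (2 * (k + 1))) ≤
      ((3 * Fintype.card ι : ℝ) ^ 2) ^ (2 * (k + 1)) * D := by
  have hD0 : 0 ≤ D := le_trans (gev_nonneg _ _ _ fun σ => by
    rw [pow_mul]; positivity) hD
  set u : (ι ⊕ (ι ⊕ ι) → C) → (ι ⊕ (ι ⊕ ι)) × (ι ⊕ (ι ⊕ ι)) → ℝ := fun σ r =>
    if r.1 = r.2 then 0 else |covRate a e (σ r.1) (σ r.2)| with hu
  have hu0 : ∀ σ r, 0 ≤ u σ r := fun σ r => by simp only [hu]; split_ifs <;> positivity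
  set m : ℝ := ((univ : Finset ((ι ⊕ (ι ⊕ ι)) × (ι ⊕ (ι ⊕ ι)))).card : ℝ) with hm
  have hme : m = (3 * Fintype.card ι : ℝ) ^ 2 := by
    simp only [hm, Finset.card_univ, Fintype.card_prod, Fintype.card_sum]
    push_cast; ring
  have hm0 : 0 ≤ m := Nat.cast_nonneg _
  have pt : ∀ σ : ι ⊕ (ι ⊕ ι) → C, derivFactor a e ι σ ^ (2 * (k + 1)) ≤
      m ^ (2 * k + 1) * ∑ r, u σ r ^ (2 * (k + 1)) := by
    intro σ
    have h1 := abs_derivFactor_le_sum a hd σ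
    rw [← Fintype.sum_prod_type' (f := fun r r' =>
      if r = r' then (0 : ℝ) else |covRate a e (σ r) (σ r')|)] at h1
    have h3 := pow_sum_div_card_le_sum_pow (s := univ) (f := u σ) (n := 2 * k + 1)
      (fun r _ => hu0 σ r)
    have e1 : 2 * k + 1 + 1 = 2 * (k + 1) := by ring
    rw [e1] at h3
    calc derivFactor a e ι σ ^ (2 * (k + 1)) = |derivFactor a e ι σ| ^ (2 * (k + 1)) := by
          rw [pow_mul, pow_mul, sq_abs]
      _ ≤ (∑ r, u σ r) ^ (2 * (k + 1)) := pow_le_pow_left₀ (abs_nonneg _) h1 _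
      _ ≤ _ := by
          rcases hm0.eq_or_lt with h0 | h0
          · have : IsEmpty ((ι ⊕ (ι ⊕ ι)) × (ι ⊕ (ι ⊕ ι))) := by
              rw [hm, eq_comm, Nat.cast_eq_zero, Finset.card_eq_zero] at h0
              exact Finset.univ_eq_empty_iff.1 h0
            simp
          · rw [div_le_iff₀ (by positivity)] at h3
            linarith
  have hr : ∀ r, rev a b v (fun σ => u σ r ^ (2 * (k + 1))) ≤ D := by
    rintro ⟨r, r'⟩
    by_cases h : r = r'
    · simp only [hu, h, if_true]
      simpa [rev, gev_const] using hD0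
    · refine le_trans (le_of_eq ?_) hD
      have hinj : Function.Injective ![r, r'] := by
        intro i j hij
        fin_cases i <;> fin_cases j <;> simp_all [eq_comm]
      rw [← rev_comp a b v ![r, r'] hinj]
      congr 1
      ext σ
      simp only [hu, h, if_false, Function.comp_apply, Matrix.cons_val_zero, Matrix.cons_val_one]
      rw [pow_mul, sq_abs, ← pow_mul]
  calc _ ≤ rev a b v (fun σ => m ^ (2 * k + 1) * ∑ r, u σ r ^ (2 * (k + 1))) :=
        gev_mono _ _ _ pt
    _ = m ^ (2 * k + 1) * ∑ r, rev a b v (fun σ => u σ r ^ (2 * (k + 1))) := by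
        simp only [rev]
        rw [gev_const_mul, gev_sum]
    _ ≤ m ^ (2 * k + 1) * ∑ r : (ι ⊕ (ι ⊕ ι)) × (ι ⊕ (ι ⊕ ι)), D := by
        gcongr; exact hr _
    _ = _ := by
        rw [Finset.sum_const, nsmul_eq_mul, ← hm, ← hme]
        ring

/-- The iterated derivatives of an interpolated expectation are expectations of a function with
the same second moment multiplied by a factor whose moments are controlled by those of
`covRate`. -/
lemma exists_iteratedDeriv_factor (B : ℕ → ℝ) (n j : ℕ) : ∃ K : ℕ → ℝ,
    ∀ {κ C : Type} [Fintype κ] [Fintype C] [Nonempty C] (a : κ → C → ℝ) (b : C → ℝ)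
      (p e : κ → ℝ) (N : ℝ), 0 < N →
      (∀ k, ∀ s ∈ Set.Ioo (0 : ℝ) 1, e k = 0 ∨ 0 < p k + s * e k) →
      (∀ σ τ, covRate a e σ σ = covRate a e τ τ) →
      (∀ r, ∀ s ∈ Set.Icc (0 : ℝ) 1, rev a b (fun k => p k + s * e k)
        (fun σ : Fin 2 → C => covRate a e (σ 0) (σ 1) ^ (2 * r)) ≤ B r / N ^ r) →
      ∀ (ι : Type) [Fintype ι] [DecidableEq ι], Fintype.card ι = n → ∀ f : (ι → C) → ℝ,
      ∃ (ι' : Type) (_ : Fintype ι') (_ : DecidableEq ι') (f₀ W : (ι' → C) → ℝ),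
        Fintype.card ι' = 3 ^ j * n ∧
        (∀ s ∈ Set.Icc (0 : ℝ) 1,
          iteratedDerivWithin j (fun s => rev a b (fun k => p k + s * e k) f) (Set.Icc 0 1) s =
            rev a b (fun k => p k + s * e k) (fun σ => f₀ σ * W σ)) ∧
        (∀ s, rev a b (fun k => p k + s * e k) (fun σ => f₀ σ ^ 2) =
          rev a b (fun k => p k + s * e k) (fun σ => f σ ^ 2)) ∧
        ∀ r, ∀ s ∈ Set.Icc (0 : ℝ) 1,
          rev a b (fun k => p k + s * e k) (fun σ => W σ ^ (2 * r)) ≤ K r / N ^ (j * r) := by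
  induction j with
  | zero =>
    refine ⟨fun _ => 1, ?_⟩
    intro κ C _ _ _ a b p e N hN hpos hd hB ι _ _ hι f
    refine ⟨ι, inferInstance, inferInstance, f, fun _ => 1, by simpa using hι, ?_, ?_, ?_⟩
    · intro s hs; simp
    · intro s; rfl
    · intro r s hs; simp [rev, gev_const]
  | succ j ih =>
    obtain ⟨K, hK⟩ := ih
    set BV : ℕ → ℝ := fun r => 1 + ((3 * (3 ^ j * n : ℕ) : ℝ) ^ 2) ^ (2 * r) * B r with hBV
    refine ⟨fun r => √(K (2 * r)) * √(BV (2 * r)), ?_⟩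
    intro κ C _ _ _ a b p e N hN hpos hd hB ι _ _ hι f
    obtain ⟨ι', i1, i2, f₀, W, hc, hit, hsq, hW⟩ := hK a b p e N hN hpos hd hB ι hι f
    have hV : ∀ r, ∀ s ∈ Set.Icc (0 : ℝ) 1, rev a b (fun k => p k + s * e k)
        (fun σ => derivFactor a e ι' σ ^ (2 * r)) ≤ BV r / N ^ r := by
      intro r s hs
      have hBr := hB r s hs
      rcases r with _ | k
      · simp only [mul_zero, pow_zero, rev, gev_const, div_one, one_mul, hBV] at hBr ⊢
        linarith
      · refine (rev_derivFactor_pow_le a b hd hBr ι').trans ?_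
        rw [hc, ← mul_div_assoc]
        gcongr
        simp only [hBV]
        linarith
    refine ⟨ι' ⊕ (ι' ⊕ ι'), inferInstance, inferInstance, fun σ => f₀ (σ ∘ .inl),
      fun σ => W (σ ∘ .inl) * derivFactor a e ι' σ, ?_, ?_, ?_, ?_⟩
    · simp only [Fintype.card_sum, hc]; ring
    · intro s hs
      rw [iteratedDerivWithin_succ, derivWithin_congr hit (hit s hs),
        (rev_hasDerivWithinAt a b p e hpos _ s hs).derivWithin
          (uniqueDiffOn_Icc zero_lt_one s hs)]
      simp only [mul_assoc]
    · intro s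
      rw [← hsq s]
      exact rev_comp a b _ Sum.inl Sum.inl_injective (fun σ => f₀ σ ^ 2)
    · intro r s hs
      have h1 := abs_gev_mul_le (repA a (ι' ⊕ (ι' ⊕ ι'))) (repB b _) (fun k => p k + s * e k)
        (fun σ => W (σ ∘ .inl) ^ (2 * r)) (fun σ => derivFactor a e ι' σ ^ (2 * r))
      simp only [← mul_pow, ← pow_mul] at h1
      have e2 : 2 * r * 2 = 2 * (2 * r) := by ring
      rw [e2] at h1
      refine (le_abs_self _).trans (h1.trans ?_)
      have h2 := rev_comp a b (fun k => p k + s * e k) (Sum.inl : ι' → ι' ⊕ (ι' ⊕ ι'))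
        Sum.inl_injective (fun σ => W σ ^ (2 * (2 * r)))
      have h3 := hW (2 * r) s hs
      rw [← h2] at h3
      calc _ ≤ √(K (2 * r) / N ^ (j * (2 * r))) * √(BV (2 * r) / N ^ (2 * r)) := by
            gcongr
            exact hV _ s hs
        _ = _ := by
            have p1 : N ^ (j * (2 * r)) = (N ^ (j * r)) ^ 2 := by rw [← pow_mul]; ring_nf
            have p2 : N ^ (2 * r) = (N ^ r) ^ 2 := by rw [← pow_mul]; ring_nf
            rw [p1, p2, Real.sqrt_div' _ (by positivity), Real.sqrt_div' _ (by positivity),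
              Real.sqrt_sq (by positivity), Real.sqrt_sq (by positivity), div_mul_div_comm,
              ← pow_add]
            ring_nf

/-- Taylor expansion of an interpolated expectation, with a remainder controlled by the moments
of `covRate`. -/
lemma exists_rev_taylor_bound (B : ℕ → ℝ) (c : ℝ) (hc0 : 0 ≤ c) (n m : ℕ) : ∃ K : ℝ,
    ∀ {κ C : Type} [Fintype κ] [Fintype C] [Nonempty C] (a : κ → C → ℝ) (b : C → ℝ)
      (p e : κ → ℝ) (N : ℝ), 0 < N →
      (∀ k, ∀ s ∈ Set.Ioo (0 : ℝ) 1, e k = 0 ∨ 0 < p k + s * e k) →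
      (∀ σ τ, covRate a e σ σ = covRate a e τ τ) →
      (∀ σ τ, |covRate a e σ τ| ≤ c) →
      (∀ r, ∀ s ∈ Set.Icc (0 : ℝ) 1, rev a b (fun k => p k + s * e k)
        (fun σ : Fin 2 → C => covRate a e (σ 0) (σ 1) ^ (2 * r)) ≤ B r / N ^ r) →
      ∀ f : (Fin n → C) → ℝ,
        |rev a b (fun k => p k + 1 * e k) f -
            ∑ j ∈ Finset.range (m + 1),
              iteratedDerivWithin j (fun s => rev a b (fun k => p k + s * e k) f)
                (Set.Icc 0 1) 0 / (Nat.factorial j)| ≤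
          K / N ^ (((m : ℝ) + 1) / 2) *
            √(rev a b (fun k => p k + 1 * e k) (fun σ => f σ ^ 2)) := by
  choose K hK using fun j => exists_iteratedDeriv_factor B n j
  refine ⟨√(Real.exp (3 * (n : ℝ) ^ 2 * c)) * √(K (m + 1) 1), ?_⟩
  intro κ C _ _ _ a b p e N hN hpos hd hc hB f
  set F : ℝ → ℝ := fun s => rev a b (fun k => p k + s * e k) f with hF
  have hsmooth : ContDiffOn ℝ (m + 1 : ℕ) F (Set.Icc 0 1) := by
    refine contDiffOn_of_differentiableOn_deriv fun k _ => ?_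
    obtain ⟨ι', i1, i2, f₀, W, -, hit, -, -⟩ :=
      hK k a b p e N hN hpos hd hB (Fin n) (Fintype.card_fin n) f
    refine DifferentiableOn.congr (fun s hs => ?_) hit
    exact (rev_hasDerivWithinAt a b p e hpos _ s hs).differentiableWithinAt
  obtain ⟨ι', i1, i2, f₀, W, -, hit, hsq, hW⟩ :=
    hK (m + 1) a b p e N hN hpos hd hB (Fin n) (Fintype.card_fin n) f
  have hbound : ∀ s ∈ Set.Icc (0 : ℝ) 1, ‖iteratedDerivWithin (m + 1) F (Set.Icc 0 1) s‖ ≤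
      √(Real.exp (3 * (n : ℝ) ^ 2 * c)) * √(K (m + 1) 1) / N ^ (((m : ℝ) + 1) / 2) *
        √(rev a b (fun k => p k + 1 * e k) (fun σ => f σ ^ 2)) := by
    intro s hs
    rw [hit s hs, Real.norm_eq_abs]
    have h1 := abs_gev_mul_le (repA a ι') (repB b ι') (fun k => p k + s * e k) f₀ W
    have h2 : rev a b (fun k => p k + s * e k) (fun σ => f₀ σ ^ 2) ≤
        Real.exp (3 * (n : ℝ) ^ 2 * c) *
          rev a b (fun k => p k + 1 * e k) (fun σ => f σ ^ 2) := by
      rw [hsq s]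
      have := rev_le_exp_mul_rev_one a b p e hpos hc0 hc (f := fun σ : Fin n → C => f σ ^ 2)
        (fun σ => sq_nonneg _) hs
      rwa [Fintype.card_fin] at this
    have h3 : rev a b (fun k => p k + s * e k) (fun σ => W σ ^ 2) ≤
        K (m + 1) 1 / N ^ (m + 1) := by simpa using hW 1 s hs
    have h4 : √(N ^ (m + 1)) = N ^ (((m : ℝ) + 1) / 2) := by
      rw [Real.sqrt_eq_rpow, ← Real.rpow_natCast, ← Real.rpow_mul hN.le]
      push_cast
      ring_nf
    calc _ ≤ √(Real.exp (3 * (n : ℝ) ^ 2 * c) *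
          rev a b (fun k => p k + 1 * e k) (fun σ => f σ ^ 2)) *
            √(K (m + 1) 1 / N ^ (m + 1)) := by
          refine h1.trans ?_
          gcongr
      _ = _ := by
          rw [Real.sqrt_mul (Real.exp_pos _).le, Real.sqrt_div' _ (by positivity), h4]
          ring
  have ht := taylor_mean_remainder_bound (n := m) zero_le_one (by exact_mod_cast hsmooth)
    (Set.right_mem_Icc.2 zero_le_one) hbound
  rw [taylor_within_apply] at ht
  simp only [sub_zero, one_pow, mul_one, smul_eq_mul, Real.norm_eq_abs] at ht
  have e1 : ∑ j ∈ Finset.range (m + 1),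
      iteratedDerivWithin j F (Set.Icc 0 1) 0 / (Nat.factorial j) =
      ∑ j ∈ Finset.range (m + 1),
        (Nat.factorial j : ℝ)⁻¹ * iteratedDerivWithin j F (Set.Icc 0 1) 0 :=
    Finset.sum_congr rfl fun j _ => by ring
  rw [e1]
  refine ht.trans (div_le_self (by positivity) ?_)
  exact_mod_cast Nat.factorial_pos m

end Iteration

section Model

lemma abs_spin (b : Bool) : |spin b| = 1 := by cases b <;> simp [spin]

/-- The coefficients of the SK Hamiltonian with additional Gaussian fields on every site. -/
def skA (N : ℕ) (β q : ℝ) : (Fin N × Fin N) ⊕ Fin N → Cfg N → ℝ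
  | .inl p, σ => if p.1 < p.2 then β / √N * (spin (σ p.1) * spin (σ p.2)) else 0
  | .inr i, σ => β * √q * spin (σ i)

/-- The deterministic external field. -/
def skB (N : ℕ) (h : ℝ) (σ : Cfg N) : ℝ := h * ∑ i, spin (σ i)

/-- The initial variances of the two-coordinate interpolation. -/
def cavP (M : ℕ) : (Fin (M + 2) × Fin (M + 2)) ⊕ Fin (M + 2) → ℝ
  | .inl p => if (p.1 : ℕ) < M ∧ (p.2 : ℕ) < M then 1 else 0
  | .inr i => if (i : ℕ) < M then 0 else 1

/-- The variance rates of the two-coordinate interpolation. -/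
def cavE (M : ℕ) : (Fin (M + 2) × Fin (M + 2)) ⊕ Fin (M + 2) → ℝ
  | .inl p => if (p.1 : ℕ) < M ∧ (p.2 : ℕ) < M then 0 else 1
  | .inr i => if (i : ℕ) < M then 0 else -1

/-- The initial variances of the interpolation decoupling all sites. -/
def decP (N : ℕ) : (Fin N × Fin N) ⊕ Fin N → ℝ
  | .inl _ => 0
  | .inr _ => 1

/-- The variance rates of the interpolation decoupling all sites. -/
def decE (N : ℕ) : (Fin N × Fin N) ⊕ Fin N → ℝ
  | .inl _ => 1
  | .inr _ => -1

lemma cavity_var_one (M : ℕ) :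
    (fun k => cavP M k + 1 * cavE M k) = fun k => decP (M + 2) k + 1 * decE (M + 2) k := by
  ext k
  rcases k with p | i <;> simp only [cavP, cavE, decP, decE] <;> split_ifs <;> norm_num

lemma cavity_pos (M : ℕ) (k) (s : ℝ) (hs : s ∈ Set.Ioo (0 : ℝ) 1) :
    cavE M k = 0 ∨ 0 < cavP M k + s * cavE M k := by
  rcases k with p | i <;> simp only [cavP, cavE] <;> split_ifs <;> simp [hs.1, hs.2]

lemma dec_pos (N : ℕ) (k) (s : ℝ) (hs : s ∈ Set.Ioo (0 : ℝ) 1) :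
    decE N k = 0 ∨ 0 < decP N k + s * decE N k := by
  rcases k with p | i <;> simp [decP, decE, hs.1, hs.2]

/-- Relabelling of the Gaussian variables of the two-coordinate interpolation. -/
lemma measurePreserving_disorder (N : ℕ) :
    MeasurePreserving (fun x : (Fin N → Fin N → ℝ) × (ℝ × ℝ) =>
        (Sum.elim (fun p : Fin N × Fin N => x.1 p.1 p.2) ![x.2.1, x.2.2] :
          (Fin N × Fin N) ⊕ Fin 2 → ℝ))
      ((gaussN N).prod ((gaussianReal 0 1).prod (gaussianReal 0 1)))
      (stdG ((Fin N × Fin N) ⊕ Fin 2)) := by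
  have hm : Measurable (fun x : (Fin N → Fin N → ℝ) × (ℝ × ℝ) =>
      (Sum.elim (fun p : Fin N × Fin N => x.1 p.1 p.2) ![x.2.1, x.2.2] :
        (Fin N × Fin N) ⊕ Fin 2 → ℝ)) := by
    refine measurable_pi_lambda _ fun k => ?_
    rcases k with p | i
    · simp only [Sum.elim_inl]; fun_prop
    · fin_cases i <;> simp <;> fun_prop
  have : SigmaFinite (gaussN N) := by unfold gaussN; infer_instance
  refine ⟨hm, (Measure.pi_eq fun s hs => ?_).symm⟩
  rw [Measure.map_apply hm (MeasurableSet.univ_pi hs)]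
  have h1 : (fun x : (Fin N → Fin N → ℝ) × (ℝ × ℝ) =>
      (Sum.elim (fun p : Fin N × Fin N => x.1 p.1 p.2) ![x.2.1, x.2.2] :
        (Fin N × Fin N) ⊕ Fin 2 → ℝ)) ⁻¹' Set.univ.pi s =
      (Set.univ.pi fun i => Set.univ.pi fun j => s (.inl (i, j))) ×ˢ
        (s (.inr 0) ×ˢ s (.inr 1)) := by
    ext x
    simp [Set.mem_pi, Sum.forall, Fin.forall_fin_two]
  rw [h1, Measure.prod_prod, Measure.prod_prod, gaussN, Measure.pi_pi]
  simp only [Measure.pi_pi, Fintype.prod_sum_type, Fin.prod_univ_two, Fintype.prod_prod_type]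

lemma negHt2_eq_linH (M : ℕ) (β h q s : ℝ) (g : Fin (M + 2) → Fin (M + 2) → ℝ) (z₁ z₂ : ℝ)
    (x : (Fin (M + 2) × Fin (M + 2)) ⊕ Fin (M + 2) → ℝ)
    (hg : ∀ i j, x (.inl (i, j)) = g i j) (h₁ : x (.inr (Fin.last (M + 1))) = z₁)
    (h₂ : x (.inr (Fin.last M).castSucc) = z₂) (σ : Cfg (M + 2)) :
    negHt2 M β h q s g z₁ z₂ σ =
      linH (skA (M + 2) β q) (skB (M + 2) h)
        (fun k => √(cavP M k + s * cavE M k) * x k) σ := by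
  subst h₁ h₂
  simp only [linH, skB, Fintype.sum_sum_type, Fintype.sum_prod_type, skA, cavP, cavE, hg]
  rw [negHt2]
  have e0 : ((M + 2 : ℕ) : ℝ) = (M : ℝ) + 2 := by push_cast; ring
  rw [e0]
  simp only [Fin.sum_univ_castSucc (n := M + 1), Fin.sum_univ_castSucc (n := M)]
  have hlt : ∀ i : Fin M, (i.castSucc.castSucc : Fin (M + 2)) < (Fin.last M).castSucc := fun i => by
    rw [Fin.lt_def]; simp
  have hlt' : ∀ i : Fin M, ¬ (Fin.last M).castSucc < (i.castSucc.castSucc : Fin (M + 2)) :=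
    fun i => not_lt.2 (hlt i).le
  have hlast : ∀ i : Fin (M + 2), ¬ Fin.last (M + 1) < i := fun i => not_lt.2 (Fin.le_last i)
  simp [hlt, hlt', hlast, Fin.castSucc_lt_last, Finset.mul_sum, Finset.sum_add_distrib, mul_add,
    ← sub_eq_add_neg]
  simp only [mul_comm, mul_left_comm, mul_assoc]
  ring

/-- The two-coordinate interpolation as an expected Gibbs average of a Gaussian system. -/
lemma nuT2_eq_rev (M : ℕ) (β h q s : ℝ) {ι : Type} [DecidableEq ι] [Fintype ι]
    (f : (ι → Cfg (M + 2)) → ℝ) :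
    nuT2 M β h q s f =
      rev (skA (M + 2) β q) (skB (M + 2) h) (fun k => cavP M k + s * cavE M k) f := by
  classical
  set v : (Fin (M + 2) × Fin (M + 2)) ⊕ Fin (M + 2) → ℝ := fun k => cavP M k + s * cavE M k
    with hv
  set ext : ((Fin (M + 2) × Fin (M + 2)) ⊕ Fin 2 → ℝ) →
      (Fin (M + 2) × Fin (M + 2)) ⊕ Fin (M + 2) → ℝ := fun y =>
    Sum.elim (fun p => y (.inl p)) (fun i => if i = Fin.last (M + 1) then y (.inr 0)
      else y (.inr 1)) with hext
  set Φ : ((Fin (M + 2) × Fin (M + 2)) ⊕ Fin 2 → ℝ) → ℝ := fun y =>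
    rav (skA (M + 2) β q) (skB (M + 2) h) (fun k => √(v k) * ext y k) f with hΦ
  have hextc : Continuous ext := by
    refine continuous_pi fun k => ?_
    rcases k with p | i
    · simp only [hext, Sum.elim_inl]; fun_prop
    · simp only [hext, Sum.elim_inr]; split_ifs <;> fun_prop
  have hΦc : Continuous Φ := (continuous_gav _ _ f).comp (by fun_prop)
  set e : (Fin (M + 2) × Fin (M + 2)) ⊕ Fin 2 → (Fin (M + 2) × Fin (M + 2)) ⊕ Fin (M + 2) :=
    Sum.map id ![Fin.last (M + 1), (Fin.last M).castSucc] with he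
  have hne : (Fin.last M).castSucc ≠ Fin.last (M + 1) := (Fin.castSucc_lt_last _).ne
  have hinj : Function.Injective e := by
    refine Sum.map_injective.2 ⟨Function.injective_id, fun i j hij => ?_⟩
    fin_cases i <;> fin_cases j <;> simp_all [eq_comm]
  have hp := measurePreserving_disorder (M + 2)
  have hp' : MeasurePreserving (fun x => x ∘ e) (stdG ((Fin (M + 2) × Fin (M + 2)) ⊕ Fin (M + 2)))
      (stdG ((Fin (M + 2) × Fin (M + 2)) ⊕ Fin 2)) := measurePreserving_pi_comp _ e hinj
  have step1 : nuT2 M β h q s f = ∫ y, Φ y ∂stdG ((Fin (M + 2) × Fin (M + 2)) ⊕ Fin 2) := by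
    rw [nuT2, ← hp.map_eq, integral_map hp.aemeasurable hΦc.aestronglyMeasurable]
    congr 1
    ext gz
    have hH : ∀ σ, negHt2 M β h q s gz.1 gz.2.1 gz.2.2 σ = _ := fun σ =>
      negHt2_eq_linH M β h q s gz.1 gz.2.1 gz.2.2
        (ext (Sum.elim (fun p => gz.1 p.1 p.2) ![gz.2.1, gz.2.2]))
        (fun i j => by simp [hext]) (by simp [hext]) (by simp [hext, hne]) σ
    simp only [gibbsT2, hH, hΦ, rav, gav, linH_rep, Real.exp_sum]
    rw [← sum_prod_replicas]
  have step2 : rev (skA (M + 2) β q) (skB (M + 2) h) v f =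
      ∫ y, Φ y ∂stdG ((Fin (M + 2) × Fin (M + 2)) ⊕ Fin 2) := by
    rw [rev, gev, ← hp'.map_eq, integral_map hp'.aemeasurable hΦc.aestronglyMeasurable]
    congr 1
    ext x
    simp only [hΦ]
    congr 1
    ext k
    rcases k with p | i
    · simp [hext, he]
    · by_cases hi : (i : ℕ) < M
      · simp [hv, cavP, cavE, hi]
      · have : i = Fin.last (M + 1) ∨ i = (Fin.last M).castSucc := by
          simp only [Fin.ext_iff, Fin.val_last, Fin.val_castSucc]; omega
        rcases this with rfl | rfl
        · simp [hext, he]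
        · simp [hext, he, hne]
  rw [step1, step2]

lemma sum_sq_ordered {N : ℕ} (x : Fin N → ℝ) (hx : ∀ i, x i ^ 2 = 1) :
    ∑ i, ∑ j, (if i < j then x i * x j else 0) = ((∑ i, x i) ^ 2 - N) / 2 := by
  have h1 : (∑ i, x i) ^ 2 = ∑ i, ∑ j, ((if i < j then x i * x j else 0) +
      (if j < i then x i * x j else 0) + if i = j then x i ^ 2 else 0) := by
    rw [sq, Finset.sum_mul_sum]
    refine Finset.sum_congr rfl fun i _ => Finset.sum_congr rfl fun j _ => ?_
    rcases lt_trichotomy i j with h | h | h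
    · simp [h, h.ne, h.le]
    · subst h; simp [sq]
    · simp [h, h.ne', h.le]
  have h2 : ∑ i, ∑ j, (if j < i then x i * x j else 0) =
      ∑ i, ∑ j, (if i < j then x i * x j else 0) := by
    rw [Finset.sum_comm]
    simp only [mul_comm]
  simp only [Finset.sum_add_distrib, h2, Finset.sum_ite_eq, mem_univ, if_true, hx] at h1
  simp at h1
  linarith

lemma spin_pair_sq (a b : Bool) : (spin a * spin b) ^ 2 = 1 := by
  rw [mul_pow, sq, sq, spin_mul_self, spin_mul_self, one_mul]

lemma covRate_dec {N : ℕ} (hN : 0 < N) (β : ℝ) {q : ℝ} (hq : 0 ≤ q) (σ τ : Cfg N) :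
    covRate (skA N β q) (decE N) σ τ =
      β ^ 2 * N / 2 * (overlap N σ τ - q) ^ 2 - β ^ 2 / 2 * (1 + N * q ^ 2) := by
  have hN' : (0 : ℝ) < N := by exact_mod_cast hN
  have h1 := sum_sq_ordered (fun i => spin (σ i) * spin (τ i)) fun i => spin_pair_sq _ _
  have hs : √(N : ℝ) ^ 2 = N := Real.sq_sqrt hN'.le
  have hsq : √q ^ 2 = q := Real.sq_sqrt hq
  simp only [covRate, Fintype.sum_sum_type, Fintype.sum_prod_type, skA, decE, one_mul]
  have e1 : ∀ i j : Fin N, ((if i < j then β / √(N : ℝ) * (spin (σ i) * spin (σ j)) else 0) *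
      if i < j then β / √(N : ℝ) * (spin (τ i) * spin (τ j)) else 0) =
      β ^ 2 / N * if i < j then (spin (σ i) * spin (τ i)) * (spin (σ j) * spin (τ j)) else 0 := by
    intro i j
    have hr : β / √(N : ℝ) * (β / √(N : ℝ)) = β ^ 2 / N := by
      rw [div_mul_div_comm, ← sq, ← sq, hs]
    split_ifs
    · rw [← hr]; ring
    · simp
  have e2 : ∀ i : Fin N, -1 * (β * √q * spin (σ i) * (β * √q * spin (τ i))) =
      -(β ^ 2 * q) * (spin (σ i) * spin (τ i)) := fun i => by
    linear_combination -(β ^ 2 * spin (σ i) * spin (τ i)) * hsq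
  simp only [e1, e2, ← Finset.mul_sum, h1, overlap]
  field_simp
  ring

lemma covRate_cav (M : ℕ) (β : ℝ) {q : ℝ} (hq : 0 ≤ q) (σ τ : Cfg (M + 2)) :
    covRate (skA (M + 2) β q) (cavE M) σ τ =
      β ^ 2 * ((spin (σ (Fin.last (M + 1))) * spin (τ (Fin.last (M + 1))) +
        spin (σ (Fin.last M).castSucc) * spin (τ (Fin.last M).castSucc)) *
          (overlapEq M σ τ - q) +
        (spin (σ (Fin.last (M + 1))) * spin (τ (Fin.last (M + 1)))) *
        (spin (σ (Fin.last M).castSucc) * spin (τ (Fin.last M).castSucc)) / (M + 2)) := by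
  have hr : β / √((M : ℝ) + 2) * (β / √((M : ℝ) + 2)) = β ^ 2 / (M + 2) := by
    rw [div_mul_div_comm, ← sq, ← sq, Real.sq_sqrt (by positivity)]
  have hsq : √q ^ 2 = q := Real.sq_sqrt hq
  have hlt : ∀ i : Fin M, (i.castSucc.castSucc : Fin (M + 2)) < (Fin.last M).castSucc := fun i => by
    rw [Fin.lt_def]; simp
  have hlt' : ∀ i : Fin M, ¬ (Fin.last M).castSucc < (i.castSucc.castSucc : Fin (M + 2)) :=
    fun i => not_lt.2 (hlt i).le
  have hlast : ∀ i : Fin (M + 2), ¬ Fin.last (M + 1) < i := fun i => not_lt.2 (Fin.le_last i)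
  have e1 : ∀ x y z w : ℝ, β / √((M : ℝ) + 2) * (x * y) * (β / √((M : ℝ) + 2) * (z * w)) =
      β ^ 2 / (M + 2) * (y * w) * (x * z) := by
    intro x y z w
    rw [← hr]; ring
  simp only [covRate, Fintype.sum_sum_type, Fintype.sum_prod_type, skA, cavE]
  simp only [Fin.sum_univ_castSucc (n := M + 1), Fin.sum_univ_castSucc (n := M)]
  simp [hlt, hlt', hlast, Fin.castSucc_lt_last, Finset.sum_add_distrib, overlapEq]
  simp only [e1, ← Finset.mul_sum]
  linear_combination (-(β ^ 2 * (spin (σ (Fin.last (M + 1))) * spin (τ (Fin.last (M + 1))) +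
        spin (σ (Fin.last M).castSucc) * spin (τ (Fin.last M).castSucc)))) * hsq

end Model

section TimeDependent

variable {κ C : Type} [Fintype κ] [Fintype C] [Nonempty C] (a : κ → C → ℝ) (b : C → ℝ)

/-- The derivative of an interpolated expectation of a time-dependent function. -/
lemma rev_hasDerivAt_of_hasDerivAt {ι : Type} [Fintype ι] [DecidableEq ι] (p e : κ → ℝ) {s : ℝ}
    (hpos : ∀ k, e k = 0 ∨ 0 < p k + s * e k) {F : ℝ → (ι → C) → ℝ} {F' : (ι → C) → ℝ}
    (hF : ∀ σ, HasDerivAt (fun s => F s σ) (F' σ) s) :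
    HasDerivAt (fun s => rev a b (fun k => p k + s * e k) (F s))
      (rev a b (fun k => p k + s * e k) F' + rev a b (fun k => p k + s * e k)
        (fun σ : ι ⊕ (ι ⊕ ι) → C => F s (σ ∘ .inl) * derivFactor a e ι σ)) s := by
  classical
  have hm : ∀ σ, HasDerivAt
      (fun s => gevMass (repA a ι) (repB b ι) (fun k => p k + s * e k) σ)
      (rev a b (fun k => p k + s * e k) fun τ : ι ⊕ (ι ⊕ ι) → C =>
        (if τ ∘ .inl = σ then 1 else 0) * derivFactor a e ι τ) s := fun σ => by
    convert rev_hasDerivAt a b p e hpos (fun τ => if τ = σ then 1 else 0) using 3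
    simp only [gevMass]
    congr!
  have h := HasDerivAt.fun_sum (u := univ) fun σ _ => (hF σ).mul (hm σ)
  have e1 : (fun s => rev a b (fun k => p k + s * e k) (F s)) = fun s =>
      ∑ σ, F s σ * gevMass (repA a ι) (repB b ι) (fun k => p k + s * e k) σ := by
    ext s
    exact gev_eq_sum _ _ _ _
  rw [e1]
  refine h.congr_deriv ?_
  rw [Finset.sum_add_distrib]
  congr 1
  · exact (gev_eq_sum _ _ _ _).symm
  · simp only [rev, ← gev_const_mul]
    rw [← gev_sum]
    congr 1
    ext τ
    simp

end TimeDependent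

section ExponentialBound

lemma overlap_self {N : ℕ} (hN : 0 < N) (σ : Cfg N) : overlap N σ σ = 1 := by
  have : (N : ℝ) ≠ 0 := by positivity
  simp [overlap, spin_mul_self, this]

lemma derivFactor_dec_le {N : ℕ} (hN : 0 < N) (β : ℝ) {q : ℝ} (hq : 0 ≤ q)
    (σ : Fin 2 ⊕ (Fin 2 ⊕ Fin 2) → Cfg N) :
    derivFactor (skA N β q) (decE N) (Fin 2) σ ≤ β ^ 2 * N / 2 *
      ((overlap N (σ (.inl 0)) (σ (.inl 1)) - q) ^ 2 +
        ∑ l, ∑ l', (overlap N (σ (.inr (.inl l))) (σ (.inr (.inr l'))) - q) ^ 2) := by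
  have comm : ∀ σ τ : Cfg N, overlap N σ τ = overlap N τ σ := fun σ τ => by
    simp only [overlap, mul_comm]
  simp only [derivFactor, covRate_dec hN β hq, Fin.sum_univ_two, overlap_self hN]
  rw [comm (σ (.inl 1)) (σ (.inl 0)), comm (σ (.inr (.inl 1))) (σ (.inr (.inl 0)))]
  have hc : 0 ≤ β ^ 2 * N / 2 := by positivity
  have hX : ∀ r r', 0 ≤ β ^ 2 * N / 2 * (overlap N (σ r) (σ r') - q) ^ 2 := fun r r' => by
    positivity
  linarith [hX (.inl 0) (.inr (.inl 0)), hX (.inl 0) (.inr (.inl 1)), hX (.inl 1) (.inr (.inl 0)),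
    hX (.inl 1) (.inr (.inl 1)), hX (.inr (.inl 0)) (.inr (.inl 1))]

lemma exp_mul_mul_le {c x y : ℝ} (hc : 0 ≤ c) (hx : 0 ≤ x) (hy : 0 ≤ y) :
    Real.exp (c * x) * y ≤ Real.exp (c * x) * x + Real.exp (c * y) * y := by
  rcases le_total y x with h | h
  · have : Real.exp (c * x) * y ≤ Real.exp (c * x) * x := by gcongr
    have : 0 ≤ Real.exp (c * y) * y := by positivity
    linarith
  · have : Real.exp (c * x) * y ≤ Real.exp (c * y) * y := by gcongr
    have : 0 ≤ Real.exp (c * x) * x := by positivity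
    linarith

/-- Exponential moments of the overlap fluctuation decrease along the decoupling path when the
exponent is suitably decreased. -/
lemma rev_exp_overlap_le {N : ℕ} (hN : 0 < N) (β h : ℝ) {q r : ℝ} (hq : 0 ≤ q)
    (hr : 9 / 2 * β ^ 2 ≤ r) :
    rev (skA N β q) (skB N h) (fun k => decP N k + 1 * decE N k)
        (fun σ : Fin 2 → Cfg N =>
          Real.exp ((r - 9 / 2 * β ^ 2) * N * (overlap N (σ 0) (σ 1) - q) ^ 2)) ≤
      rev (skA N β q) (skB N h) (decP N)
        (fun σ : Fin 2 → Cfg N => Real.exp (r * N * (overlap N (σ 0) (σ 1) - q) ^ 2)) := by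
  set X : (Fin 2 → Cfg N) → ℝ := fun σ => (overlap N (σ 0) (σ 1) - q) ^ 2 with hX
  have hX0 : ∀ σ, 0 ≤ X σ := fun σ => sq_nonneg _
  set F : ℝ → (Fin 2 → Cfg N) → ℝ := fun s σ => Real.exp ((r - 9 / 2 * β ^ 2 * s) * N * X σ)
    with hF
  have hFd : ∀ s σ, HasDerivAt (fun s => F s σ) (-(9 / 2 * β ^ 2 * N) * (F s σ * X σ)) s := by
    intro s σ
    have h1 : HasDerivAt (fun s => (r - 9 / 2 * β ^ 2 * s) * N * X σ)
        (-(9 / 2 * β ^ 2) * N * X σ) s := by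
      simpa using ((((hasDerivAt_id s).const_mul (9 / 2 * β ^ 2)).const_sub r).mul_const
        (N : ℝ)).mul_const (X σ)
    refine h1.exp.congr_deriv ?_
    simp only [hF]; ring
  set φ : ℝ → ℝ := fun s => rev (skA N β q) (skB N h) (fun k => decP N k + s * decE N k) (F s)
    with hφ
  have hφd : ∀ s ∈ Set.Ioo (0 : ℝ) 1, HasDerivAt φ _ s := fun s hs =>
    rev_hasDerivAt_of_hasDerivAt (skA N β q) (skB N h) (decP N) (decE N)
      (fun k => dec_pos N k s hs) (hFd s)
  have hφc : Continuous φ := by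
    have : φ = fun s => ∑ σ, F s σ * gevMass (repA (skA N β q) (Fin 2)) (repB (skB N h) (Fin 2))
        (fun k => decP N k + s * decE N k) σ := by
      ext s; exact gev_eq_sum _ _ _ _
    rw [this]
    refine continuous_finsetSum _ fun σ _ => Continuous.mul ?_ ?_
    · simp only [hF]; fun_prop
    · exact continuous_gev _ _ (by fun_prop) _
  have hanti : AntitoneOn φ (Set.Icc 0 1) := by
    refine antitoneOn_of_deriv_nonpos (convex_Icc 0 1) hφc.continuousOn ?_ ?_
    · rw [interior_Icc]
      exact fun s hs => (hφd s hs).differentiableAt.differentiableWithinAt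
    · rw [interior_Icc]
      intro s hs
      rw [(hφd s hs).deriv]
      set v := fun k => decP N k + s * decE N k
      have hrs : 0 ≤ (r - 9 / 2 * β ^ 2 * s) * N := by
        have : 9 / 2 * β ^ 2 * s ≤ 9 / 2 * β ^ 2 * 1 := by
          have := hs.2.le; gcongr
        exact mul_nonneg (by linarith) (Nat.cast_nonneg _)
      set D := rev (skA N β q) (skB N h) v (fun σ => F s σ * X σ) with hD
      have h1 : rev (skA N β q) (skB N h) v (fun σ => -(9 / 2 * β ^ 2 * N) * (F s σ * X σ)) =
          -(9 / 2 * β ^ 2 * N) * D := gev_const_mul _ _ _ _ _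
      have marg : ∀ e : Fin 2 → Fin 2 ⊕ (Fin 2 ⊕ Fin 2), Function.Injective e →
          rev (skA N β q) (skB N h) v (fun σ => F s (σ ∘ e) * X (σ ∘ e)) = D := fun e he =>
        rev_comp (skA N β q) (skB N h) v e he (fun σ => F s σ * X σ)
      have pt : ∀ σ : Fin 2 ⊕ (Fin 2 ⊕ Fin 2) → Cfg N,
          F s (σ ∘ .inl) * derivFactor (skA N β q) (decE N) (Fin 2) σ ≤
          β ^ 2 * N / 2 * (F s (σ ∘ .inl) * X (σ ∘ .inl) +
            ∑ l : Fin 2, ∑ l' : Fin 2, (F s (σ ∘ .inl) * X (σ ∘ .inl) +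
              F s (σ ∘ ![.inr (.inl l), .inr (.inr l')]) *
                X (σ ∘ ![.inr (.inl l), .inr (.inr l')]))) := by
        intro σ
        have d := derivFactor_dec_le hN β hq σ
        have hF0 : 0 ≤ F s (σ ∘ .inl) := (Real.exp_pos _).le
        refine (mul_le_mul_of_nonneg_left d hF0).trans ?_
        rw [mul_left_comm, mul_add]
        gcongr
        · exact le_rfl
        · rw [Finset.mul_sum]
          refine Finset.sum_le_sum fun l _ => ?_
          rw [Finset.mul_sum]
          refine Finset.sum_le_sum fun l' _ => ?_
          exact exp_mul_mul_le hrs (hX0 _) (hX0 (σ ∘ ![.inr (.inl l), .inr (.inr l')]))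
      have h2 : rev (skA N β q) (skB N h) v (fun σ : Fin 2 ⊕ (Fin 2 ⊕ Fin 2) → Cfg N =>
          F s (σ ∘ .inl) * derivFactor (skA N β q) (decE N) (Fin 2) σ) ≤
          9 / 2 * β ^ 2 * N * D := by
        refine (gev_mono _ _ _ pt).trans (le_of_eq ?_)
        simp only [rev] at marg
        rw [gev_const_mul, gev_add, gev_sum, marg _ Sum.inl_injective]
        have : ∀ l : Fin 2, gev (repA (skA N β q) (Fin 2 ⊕ (Fin 2 ⊕ Fin 2)))
            (repB (skB N h) (Fin 2 ⊕ (Fin 2 ⊕ Fin 2))) v (fun σ =>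
              ∑ l' : Fin 2, (F s (σ ∘ .inl) * X (σ ∘ .inl) +
              F s (σ ∘ ![.inr (.inl l), .inr (.inr l')]) *
                X (σ ∘ ![.inr (.inl l), .inr (.inr l')]))) = 4 * D := by
          intro l
          rw [gev_sum]
          have : ∀ l' : Fin 2, Function.Injective
              (![.inr (.inl l), .inr (.inr l')] : Fin 2 → Fin 2 ⊕ (Fin 2 ⊕ Fin 2)) := by
            intro l' i j hij
            fin_cases i <;> fin_cases j <;> simp_all
          simp only [gev_add, marg _ Sum.inl_injective, marg _ (this _), Fin.sum_univ_two]
          ring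
        rw [Finset.sum_congr rfl fun l _ => this l, Fin.sum_univ_two]
        ring
      rw [h1]
      linarith
  have := hanti (Set.left_mem_Icc.2 zero_le_one) (Set.right_mem_Icc.2 zero_le_one) zero_le_one
  simpa [hφ, hF, hX] using this

end ExponentialBound

section ProductCase

lemma exp_le_add_exp_sq (x : ℝ) : Real.exp x ≤ x + Real.exp (x ^ 2) := by
  have h1 := Real.add_one_le_exp (x ^ 2)
  rcases le_or_gt |x| 1 with h | h
  · have := (abs_le.1 (Real.abs_exp_sub_one_sub_id_le h)).2
    linarith
  · rcases lt_abs.1 h with h | h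
    · have : Real.exp x ≤ Real.exp (x ^ 2) := Real.exp_le_exp.2 (by nlinarith)
      linarith
    · have : Real.exp x ≤ 1 := Real.exp_le_one_iff.2 (by linarith)
      nlinarith

/-- The moment generating function of a centered `±1`-valued variable of mean `q`. -/
lemma exp_mul_cosh_add_le {q : ℝ} (hq : 0 ≤ q) (hq1 : q < 1) (s : ℝ) :
    Real.exp (-(s * q)) * (Real.cosh s + q * Real.sinh s) ≤ Real.exp (4 * s ^ 2) := by
  have e1 : Real.exp (-(s * q)) * (Real.cosh s + q * Real.sinh s) =
      (1 + q) / 2 * Real.exp (s * (1 - q)) + (1 - q) / 2 * Real.exp (-(s * (1 + q))) := by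
    have a1 : Real.exp (s * (1 - q)) = Real.exp (-(s * q)) * Real.exp s := by
      rw [← Real.exp_add]; ring_nf
    have a2 : Real.exp (-(s * (1 + q))) = Real.exp (-(s * q)) * Real.exp (-s) := by
      rw [← Real.exp_add]; ring_nf
    rw [a1, a2, Real.cosh_eq, Real.sinh_eq]
    ring
  have h1 := exp_le_add_exp_sq (s * (1 - q))
  have h2 := exp_le_add_exp_sq (-(s * (1 + q)))
  have h3 : Real.exp ((s * (1 - q)) ^ 2) ≤ Real.exp (4 * s ^ 2) := by
    apply Real.exp_le_exp.2
    have : (1 - q) ^ 2 ≤ 4 := by nlinarith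
    nlinarith [sq_nonneg s]
  have h4 : Real.exp ((-(s * (1 + q))) ^ 2) ≤ Real.exp (4 * s ^ 2) := by
    apply Real.exp_le_exp.2
    have : (1 + q) ^ 2 ≤ 4 := by nlinarith
    nlinarith [sq_nonneg s]
  rw [e1]
  nlinarith

lemma sum_prod_sites {N : ℕ} {ι : Type} [Fintype ι] [DecidableEq ι]
    (Ψ : Fin N → (ι → Bool) → ℝ) :
    ∑ σ : ι → Cfg N, ∏ i, Ψ i (fun l => σ l i) = ∏ i, ∑ c, Ψ i c := by
  rw [Fintype.prod_sum, ← (Equiv.piComm fun (_ : ι) (_ : Fin N) => Bool).sum_comp]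
  rfl

/-- The average of `exp (s (εε' - q))` for two independent spins in the field `y`. -/
lemma two_spin_average (s q y : ℝ) :
    (∑ c : Fin 2 → Bool, Real.exp (s * (spin (c 0) * spin (c 1) - q)) *
        ∏ l, Real.exp (y * spin (c l))) / ∑ c : Fin 2 → Bool, ∏ l, Real.exp (y * spin (c l)) =
      Real.exp (-(s * q)) * (Real.cosh s + Real.tanh y ^ 2 * Real.sinh s) := by
  have hs : ∀ F : (Fin 2 → Bool) → ℝ, ∑ c, F c =
      F ![true, true] + F ![true, false] + (F ![false, true] + F ![false, false]) := by
    intro F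
    rw [← (finTwoArrowEquiv Bool).symm.sum_comp, Fintype.sum_prod_type]
    simp [finTwoArrowEquiv]
  rw [hs, hs]
  simp only [Fin.prod_univ_two, Matrix.cons_val_zero, Matrix.cons_val_one, spin, if_true,
    Bool.false_eq_true, if_false]
  rw [Real.tanh_eq_sinh_div_cosh, Real.cosh_eq, Real.sinh_eq, Real.cosh_eq, Real.sinh_eq]
  have a1 : Real.exp (s * (1 - q)) = Real.exp (-(s * q)) * Real.exp s := by
    rw [← Real.exp_add]; ring_nf
  have a2 : Real.exp (s * (-1 - q)) = Real.exp (-(s * q)) * Real.exp (-s) := by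
    rw [← Real.exp_add]; ring_nf
  norm_num
  rw [a1, a2]
  have hp := Real.exp_pos y
  have hn := Real.exp_pos (-y)
  have hpn : Real.exp y * Real.exp (-y) = 1 := by rw [← Real.exp_add]; simp
  field_simp
  ring

lemma integrable_exp_sq_div_four :
    Integrable (fun w : ℝ => Real.exp (w ^ 2 / 4)) (gaussianReal 0 1) := by
  rw [gaussianReal_of_var_ne_zero _ one_ne_zero,
    integrable_withDensity_iff_integrable_smul' (measurable_gaussianPDF _ _)
      (ae_of_all _ fun _ => gaussianPDF_lt_top)]
  have h := (integrable_exp_neg_mul_sq (b := 1 / 4) (by norm_num)).const_mul (√(2 * Real.pi))⁻¹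
  refine h.congr (ae_of_all _ fun x => ?_)
  simp only [toReal_gaussianPDF, gaussianPDFReal, smul_eq_mul, NNReal.coe_one, mul_one]
  rw [mul_assoc, ← Real.exp_add]
  congr 2
  ring

lemma rev_dec_exp_linear_le {N : ℕ} (hN : 0 < N) {β h q : ℝ} (hq : 0 ≤ q) (hq1 : q < 1)
    (hfix : q = ∫ z, Real.tanh (β * z * √q + h) ^ 2 ∂ (gaussianReal 0 1 : Measure ℝ)) (s : ℝ) :
    rev (skA N β q) (skB N h) (decP N)
        (fun σ : Fin 2 → Cfg N => Real.exp (s * N * (overlap N (σ 0) (σ 1) - q))) ≤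
      Real.exp (4 * s ^ 2 * N) := by
  have hN' : (N : ℝ) ≠ 0 := by positivity
  set G : ℝ → ℝ := fun z => Real.exp (-(s * q)) *
    (Real.cosh s + Real.tanh (β * z * √q + h) ^ 2 * Real.sinh s) with hG
  have point : ∀ g : (Fin N × Fin N) ⊕ Fin N → ℝ,
      rav (skA N β q) (skB N h) (fun k => √(decP N k) * g k)
        (fun σ : Fin 2 → Cfg N => Real.exp (s * N * (overlap N (σ 0) (σ 1) - q))) =
      ∏ i, G (g (.inr i)) := by
    intro g
    have hlin : ∀ τ : Cfg N, linH (skA N β q) (skB N h) (fun k => √(decP N k) * g k) τ =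
        ∑ i, (β * g (.inr i) * √q + h) * spin (τ i) := by
      intro τ
      simp only [linH, Fintype.sum_sum_type, decP, skA, skB, Real.sqrt_zero, Real.sqrt_one,
        zero_mul, Finset.sum_const_zero, zero_add, one_mul, Finset.mul_sum]
      rw [← Finset.sum_add_distrib]
      exact Finset.sum_congr rfl fun i _ => by ring
    have hw : ∀ σ : Fin 2 → Cfg N, Real.exp (linH (repA (skA N β q) (Fin 2))
        (repB (skB N h) (Fin 2)) (fun k => √(decP N k) * g k) σ) =
        ∏ i, ∏ l, Real.exp ((β * g (.inr i) * √q + h) * spin (σ l i)) := by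
      intro σ
      rw [linH_rep]
      simp only [hlin, ← Real.exp_sum]
      rw [Finset.sum_comm]
    have hf : ∀ σ : Fin 2 → Cfg N, Real.exp (s * N * (overlap N (σ 0) (σ 1) - q)) =
        ∏ i, Real.exp (s * (spin (σ 0 i) * spin (σ 1 i) - q)) := by
      intro σ
      rw [← Real.exp_sum, ← Finset.mul_sum, Finset.sum_sub_distrib, Finset.sum_const,
        Finset.card_univ, Fintype.card_fin, nsmul_eq_mul, overlap]
      congr 1
      field_simp
    simp only [rav, gav, hw, hf, ← Finset.prod_mul_distrib]
    rw [sum_prod_sites (ι := Fin 2) (fun i c => Real.exp (s * (spin (c 0) * spin (c 1) - q)) *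
        ∏ l, Real.exp ((β * g (.inr i) * √q + h) * spin (c l))),
      sum_prod_sites (ι := Fin 2) (fun i c =>
        ∏ l, Real.exp ((β * g (.inr i) * √q + h) * spin (c l))), ← Finset.prod_div_distrib]
    exact Finset.prod_congr rfl fun i _ => two_spin_average s q _
  have hGc : Continuous G := by
    have : Continuous Real.tanh := by
      simp only [funext Real.tanh_eq_sinh_div_cosh]
      exact Real.continuous_sinh.div Real.continuous_cosh fun x => (Real.cosh_pos x).ne'
    simp only [hG]
    fun_prop
  have hT : ∀ x, Real.tanh x ^ 2 ≤ 1 := fun x => by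
    have := Real.abs_tanh_lt_one x
    rw [← sq_abs]
    exact pow_le_one₀ (abs_nonneg _) this.le
  have hint : Integrable (fun z => Real.tanh (β * z * √q + h) ^ 2) (gaussianReal 0 1) := by
    refine Integrable.mono' (integrable_const 1) ?_ (ae_of_all _ fun z => ?_)
    · have : Continuous Real.tanh := by
        simp only [funext Real.tanh_eq_sinh_div_cosh]
        exact Real.continuous_sinh.div Real.continuous_cosh fun x => (Real.cosh_pos x).ne'
      exact (by fun_prop : Continuous _).aestronglyMeasurable
    · rw [Real.norm_eq_abs, abs_of_nonneg (sq_nonneg _)]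
      exact hT _
  have hGint : ∫ z, G z ∂gaussianReal 0 1 =
      Real.exp (-(s * q)) * (Real.cosh s + q * Real.sinh s) := by
    simp only [hG]
    rw [integral_const_mul, integral_add (integrable_const _) (hint.mul_const _),
      integral_mul_const, ← hfix]
    simp
  have hG0 : 0 ≤ ∫ z, G z ∂gaussianReal 0 1 := by
    refine integral_nonneg fun z => ?_
    have h1 := hT (β * z * √q + h)
    have h2 : |Real.sinh s| ≤ Real.cosh s := by
      rw [abs_le, Real.cosh_eq, Real.sinh_eq]
      constructor <;> linarith [Real.exp_pos s, Real.exp_pos (-s)]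
    have h3 := abs_le.1 h2
    have : 0 ≤ Real.cosh s + Real.tanh (β * z * √q + h) ^ 2 * Real.sinh s := by
      nlinarith [sq_nonneg (Real.tanh (β * z * √q + h)), Real.cosh_pos s]
    exact mul_nonneg (Real.exp_pos _).le this
  have hp : MeasurePreserving (fun x : (Fin N × Fin N) ⊕ Fin N → ℝ => x ∘ Sum.inr)
      (stdG ((Fin N × Fin N) ⊕ Fin N)) (stdG (Fin N)) :=
    measurePreserving_pi_comp _ Sum.inr Sum.inr_injective
  have key : rev (skA N β q) (skB N h) (decP N)
        (fun σ : Fin 2 → Cfg N => Real.exp (s * N * (overlap N (σ 0) (σ 1) - q))) =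
      (∫ z, G z ∂gaussianReal 0 1) ^ N := by
    have : ∫ y, ∏ i, G (y i) ∂stdG (Fin N) = (∫ z, G z ∂gaussianReal 0 1) ^ N := by
      rw [stdG, integral_fintype_prod_eq_pow]
      simp
    rw [← this, ← hp.map_eq, integral_map hp.aemeasurable
      (by exact (by fun_prop : Continuous _).aestronglyMeasurable)]
    simp only [rev, gev]
    exact integral_congr_ae (ae_of_all _ fun g => point g)
  rw [key]
  calc _ ≤ Real.exp (4 * s ^ 2) ^ N := by
        refine pow_le_pow_left₀ hG0 ?_ _
        rw [hGint]
        exact exp_mul_cosh_add_le hq hq1 s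
    _ = _ := by rw [← Real.exp_nat_mul]; ring_nf

/-- The exponential moment of the overlap fluctuation for independent sites. -/
lemma rev_dec_exp_sq_le {N : ℕ} (hN : 0 < N) {β h q : ℝ} (hq : 0 ≤ q) (hq1 : q < 1)
    (hfix : q = ∫ z, Real.tanh (β * z * √q + h) ^ 2 ∂ (gaussianReal 0 1 : Measure ℝ)) :
    rev (skA N β q) (skB N h) (decP N)
        (fun σ : Fin 2 → Cfg N => Real.exp (1 / 32 * N * (overlap N (σ 0) (σ 1) - q) ^ 2)) ≤
      ∫ w, Real.exp (w ^ 2 / 4) ∂gaussianReal 0 1 := by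
  have hN' : (0 : ℝ) < N := by positivity
  set t : ℝ := √(N / 16) with ht
  have ht2 : t ^ 2 = N / 16 := Real.sq_sqrt (by positivity)
  have lin : ∀ u : ℝ, Real.exp (1 / 32 * N * u ^ 2) =
      ∫ w, Real.exp (t * u * w) ∂gaussianReal 0 1 := by
    intro u
    have h1 := mgf_gaussianReal (p := gaussianReal 0 1) (X := id) (μ := 0) (v := 1)
      (by simp) (t * u)
    simp only [mgf, id] at h1
    rw [h1]
    congr 1
    push_cast
    rw [mul_pow, ht2]
    ring
  have hi : ∀ u : ℝ, Integrable (fun w => Real.exp (t * u * w)) (gaussianReal 0 1) := fun u =>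
    integrable_exp_mul_gaussianReal _
  rw [rev, gev_eq_sum]
  simp only [lin, ← integral_mul_const]
  rw [← integral_finsetSum _ fun σ _ => (hi _).mul_const _]
  refine integral_mono (integrable_finsetSum _ fun σ _ => (hi _).mul_const _)
    integrable_exp_sq_div_four fun w => ?_
  have h2 := rev_dec_exp_linear_le hN hq hq1 hfix (w * t / N)
  rw [rev, gev_eq_sum] at h2
  have e1 : 4 * (w * t / N) ^ 2 * N = w ^ 2 / 4 := by
    rw [div_pow, mul_pow, ht2]; field_simp; ring
  rw [e1] at h2
  refine le_trans (le_of_eq (Finset.sum_congr rfl fun σ _ => ?_)) h2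
  congr 2
  field_simp

end ProductCase

lemma overlap_eq_overlapEq_add (M : ℕ) (σ τ : Cfg (M + 2)) :
    overlap (M + 2) σ τ = overlapEq M σ τ +
      (spin (σ (Fin.last (M + 1))) * spin (τ (Fin.last (M + 1))) +
        spin (σ (Fin.last M).castSucc) * spin (τ (Fin.last M).castSucc)) / (M + 2) := by
  rw [overlap, overlapEq, Fin.sum_univ_castSucc, Fin.sum_univ_castSucc]
  push_cast
  ring

lemma abs_overlap_le_one {N : ℕ} (hN : 0 < N) (σ τ : Cfg N) : |overlap N σ τ| ≤ 1 := by
  have hN' : (0 : ℝ) < N := by positivity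
  rw [overlap, abs_div, abs_of_pos hN', div_le_one hN']
  refine (abs_sum_le_sum_abs _ _).trans ?_
  simp [abs_mul, abs_spin]

lemma covRate_cav_self (M : ℕ) (β : ℝ) {q : ℝ} (hq : 0 ≤ q) (σ τ : Cfg (M + 2)) :
    covRate (skA (M + 2) β q) (cavE M) σ σ = covRate (skA (M + 2) β q) (cavE M) τ τ := by
  simp only [covRate_cav M β hq, overlapEq, spin_mul_self]

lemma abs_covRate_cav_le (M : ℕ) {β q : ℝ} (hβ : β ^ 2 ≤ 1) (hq : 0 ≤ q) (σ τ : Cfg (M + 2)) :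
    |covRate (skA (M + 2) β q) (cavE M) σ τ| ≤
      2 * |overlap (M + 2) σ τ - q| + 5 / (M + 2) := by
  rw [covRate_cav M β hq]
  set ε := spin (σ (Fin.last (M + 1))) * spin (τ (Fin.last (M + 1))) with hε
  set η := spin (σ (Fin.last M).castSucc) * spin (τ (Fin.last M).castSucc) with hη
  have hε1 : |ε| = 1 := by rw [hε, abs_mul, abs_spin, abs_spin, one_mul]
  have hη1 : |η| = 1 := by rw [hη, abs_mul, abs_spin, abs_spin, one_mul]
  have hN : (0 : ℝ) < M + 2 := by positivity
  have hsum : |ε + η| ≤ 2 := (abs_add_le _ _).trans (by rw [hε1, hη1]; norm_num)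
  have hR : overlapEq M σ τ - q = (overlap (M + 2) σ τ - q) - (ε + η) / (M + 2) := by
    rw [overlap_eq_overlapEq_add]; ring
  have hd : |(ε + η) / ((M : ℝ) + 2)| ≤ 2 / (M + 2) := by
    rw [abs_div, abs_of_pos hN]; gcongr
  have hR' : |overlapEq M σ τ - q| ≤ |overlap (M + 2) σ τ - q| + 2 / (M + 2) := by
    rw [hR]; exact (abs_sub _ _).trans (by gcongr)
  have hprod : |ε * η / ((M : ℝ) + 2)| = 1 / (M + 2) := by
    rw [abs_div, abs_mul, hε1, hη1, abs_of_pos hN, one_mul]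
  rw [abs_mul, abs_of_nonneg (sq_nonneg β)]
  calc β ^ 2 * |(ε + η) * (overlapEq M σ τ - q) + ε * η / (M + 2)|
      ≤ 1 * (2 * (|overlap (M + 2) σ τ - q| + 2 / (M + 2)) + 1 / (M + 2)) := by
        gcongr
        refine (abs_add_le _ _).trans ?_
        rw [hprod, abs_mul]
        gcongr
    _ = _ := by ring

lemma covRate_cav_pow_le (M : ℕ) {β q : ℝ} (hβ : β ^ 2 ≤ 1) (hq : 0 ≤ q) (r : ℕ)
    (σ τ : Cfg (M + 2)) :
    covRate (skA (M + 2) β q) (cavE M) σ τ ^ (2 * r) ≤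
      (16 ^ r * (r.factorial * 64 ^ r) *
        Real.exp (1 / 64 * (M + 2) * (overlap (M + 2) σ τ - q) ^ 2) + 100 ^ r) /
          ((M : ℝ) + 2) ^ r := by
  have hN : (0 : ℝ) < M + 2 := by positivity
  have hN1 : (1 : ℝ) ≤ M + 2 := by linarith [(Nat.cast_nonneg M : (0 : ℝ) ≤ M)]
  set x := overlap (M + 2) σ τ - q
  set c := covRate (skA (M + 2) β q) (cavE M) σ τ
  have hc : |c| ≤ 2 * |x| + 5 / (M + 2) := abs_covRate_cav_le M hβ hq σ τ
  have hsq : (M + 2 : ℝ) * c ^ 2 ≤ 8 * ((M + 2) * x ^ 2) + 50 := by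
    have h1 : c ^ 2 ≤ (2 * |x| + 5 / (M + 2)) ^ 2 := by
      rw [← sq_abs c]; gcongr
    have h2 : (2 * |x| + 5 / ((M : ℝ) + 2)) ^ 2 ≤ 8 * x ^ 2 + 50 / (M + 2) ^ 2 := by
      have : (5 / ((M : ℝ) + 2)) ^ 2 = 25 / (M + 2) ^ 2 := by rw [div_pow]; norm_num
      have h3 : 50 / ((M : ℝ) + 2) ^ 2 = 2 * (5 / (M + 2)) ^ 2 := by rw [this]; ring
      rw [h3]
      nlinarith [sq_nonneg (2 * |x| - 5 / ((M : ℝ) + 2)), sq_abs x]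
    have h4 : (M + 2 : ℝ) * (50 / (M + 2) ^ 2) ≤ 50 := by
      rw [mul_div_assoc', div_le_iff₀ (by positivity)]
      nlinarith
    calc (M + 2 : ℝ) * c ^ 2 ≤ (M + 2) * (8 * x ^ 2 + 50 / (M + 2) ^ 2) := by
          gcongr; exact h1.trans h2
      _ ≤ _ := by linarith
  have hexp : ((M + 2 : ℝ) * x ^ 2) ^ r ≤
      r.factorial * 64 ^ r * Real.exp (1 / 64 * (M + 2) * x ^ 2) := by
    have h := Real.pow_div_factorial_le_exp (x := 1 / 64 * (M + 2) * x ^ 2) (by positivity) r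
    have e : (M + 2 : ℝ) * x ^ 2 = 64 * (1 / 64 * (M + 2) * x ^ 2) := by ring
    rw [div_le_iff₀ (by positivity)] at h
    rw [e, mul_pow]
    calc (64 : ℝ) ^ r * (1 / 64 * (M + 2) * x ^ 2) ^ r ≤
          64 ^ r * (Real.exp (1 / 64 * (M + 2) * x ^ 2) * r.factorial) := by gcongr
      _ = _ := by ring
  rw [le_div_iff₀ (by positivity)]
  have h2 : (2 : ℝ) ^ (r - 1) ≤ 2 ^ r := pow_le_pow_right₀ (by norm_num) (Nat.sub_le _ _)
  calc c ^ (2 * r) * (M + 2 : ℝ) ^ r = ((M + 2) * c ^ 2) ^ r := by rw [pow_mul, mul_pow]; ring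
    _ ≤ (8 * ((M + 2) * x ^ 2) + 50) ^ r := by gcongr
    _ ≤ 2 ^ (r - 1) * ((8 * ((M + 2) * x ^ 2)) ^ r + 50 ^ r) :=
        add_pow_le (by positivity) (by norm_num) r
    _ ≤ 2 ^ r * (8 ^ r * (r.factorial * 64 ^ r * Real.exp (1 / 64 * (M + 2) * x ^ 2)) +
        50 ^ r) := by
        rw [mul_pow 8]; gcongr
    _ = _ := by
        rw [show (16 : ℝ) = 2 * 8 by norm_num, show (100 : ℝ) = 2 * 50 by norm_num, mul_pow,
          mul_pow]
        ring

/-- The bound for `N ^ r` times the `2 r`-th moment of the covariance rate. -/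
def cavityMomentBound (r : ℕ) : ℝ :=
  Real.exp (3 * 2 ^ 2 * 9) * (16 ^ r * (r.factorial * 64 ^ r) *
    (∫ w, Real.exp (w ^ 2 / 4) ∂gaussianReal 0 1) + 100 ^ r)

lemma abs_covRate_cav_le_nine (M : ℕ) {β q : ℝ} (hβ : β ^ 2 ≤ 1) (hq : 0 ≤ q) (hq1 : q < 1)
    (σ τ : Cfg (M + 2)) : |covRate (skA (M + 2) β q) (cavE M) σ τ| ≤ 9 := by
  refine (abs_covRate_cav_le M hβ hq σ τ).trans ?_
  have h1 := abs_le.1 (abs_overlap_le_one (N := M + 2) (by omega) σ τ)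
  have h2 : |overlap (M + 2) σ τ - q| ≤ 2 := abs_le.2 ⟨by linarith, by linarith⟩
  have h3 : 5 / ((M : ℝ) + 2) ≤ 5 / 2 := by
    gcongr; linarith [(Nat.cast_nonneg M : (0 : ℝ) ≤ M)]
  linarith

lemma rev_covRate_cav_pow_le (M : ℕ) {β h q : ℝ} (hβ0 : 0 < β) (hβ : β < 1 / 20) (hq : 0 ≤ q)
    (hq1 : q < 1)
    (hfix : q = ∫ z, Real.tanh (β * z * √q + h) ^ 2 ∂ (gaussianReal 0 1 : Measure ℝ))
    (r : ℕ) {s : ℝ} (hs : s ∈ Set.Icc (0 : ℝ) 1) :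
    rev (skA (M + 2) β q) (skB (M + 2) h) (fun k => cavP M k + s * cavE M k)
      (fun σ : Fin 2 → Cfg (M + 2) =>
        covRate (skA (M + 2) β q) (cavE M) (σ 0) (σ 1) ^ (2 * r)) ≤
      cavityMomentBound r / ((M : ℝ) + 2) ^ r := by
  have hβsq : β ^ 2 ≤ 1 / 400 := by nlinarith
  have hβ1 : β ^ 2 ≤ 1 := by linarith
  have hN : (0 : ℝ) < M + 2 := by positivity
  refine (rev_le_exp_mul_rev_one (skA (M + 2) β q) (skB (M + 2) h) (cavP M) (cavE M)
    (cavity_pos M) (c := 9) (by norm_num) (abs_covRate_cav_le_nine M hβ1 hq hq1)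
    (fun σ => (even_two_mul r).pow_nonneg _) hs).trans ?_
  rw [cavity_var_one, cavityMomentBound, Fintype.card_fin, mul_div_assoc]
  push_cast
  gcongr
  set A : ℝ := 16 ^ r * (r.factorial * 64 ^ r) with hA
  have hexp : rev (skA (M + 2) β q) (skB (M + 2) h) (fun k => decP (M + 2) k + 1 * decE (M + 2) k)
      (fun σ : Fin 2 → Cfg (M + 2) =>
        Real.exp (1 / 64 * (M + 2) * (overlap (M + 2) (σ 0) (σ 1) - q) ^ 2)) ≤
      ∫ w, Real.exp (w ^ 2 / 4) ∂gaussianReal 0 1 := by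
    refine le_trans ?_ ((rev_exp_overlap_le (N := M + 2) (by omega) β h (r := 1 / 32) hq
      (by linarith)).trans (rev_dec_exp_sq_le (by omega) hq hq1 hfix))
    refine gev_mono _ _ _ fun σ => ?_
    push_cast
    gcongr
    linarith
  calc _ ≤ rev (skA (M + 2) β q) (skB (M + 2) h)
        (fun k => decP (M + 2) k + 1 * decE (M + 2) k) (fun σ : Fin 2 → Cfg (M + 2) =>
          (((M : ℝ) + 2) ^ r)⁻¹ * (A *
            Real.exp (1 / 64 * (M + 2) * (overlap (M + 2) (σ 0) (σ 1) - q) ^ 2) + 100 ^ r)) := by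
        refine gev_mono _ _ _ fun σ => ?_
        rw [inv_mul_eq_div]
        exact covRate_cav_pow_le M hβ1 hq r (σ 0) (σ 1)
    _ ≤ _ := by
        rw [rev, gev_const_mul, gev_add, gev_const_mul, gev_const, inv_mul_eq_div]
        gcongr

/-- Lemma 6, Taylor expansion along the two-coordinate smart path:
`|ν(f) − Σ_{j≤m} ν₀₀^{(j)}(f)/j!| ≤ K·N^{-(m+1)/2}·ν(f²)^{1/2}`, where `ν = ν_1`. -/
theorem stmt9 :
    ∃ β₀ : ℝ, 0 < β₀ ∧
      ∀ n : ℕ, 1 ≤ n → ∀ m : ℕ,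
        ∃ K : ℝ, ∀ β : ℝ, 0 < β → β < β₀ → ∀ M : ℕ, ∀ h : ℝ, 0 ≤ h → ∀ q : ℝ,
          0 ≤ q → q < 1 →
          q = ∫ z, Real.tanh (β * z * Real.sqrt q + h) ^ 2 ∂ (gaussianReal 0 1 : Measure ℝ) →
          ∀ f : (Fin n → Cfg (M + 2)) → ℝ,
            |nuT2 M β h q 1 f -
                ∑ j ∈ Finset.range (m + 1),
                  iteratedDerivWithin j (fun u => nuT2 M β h q u f) (Set.Icc 0 1) 0 /
                    (Nat.factorial j)| ≤
              K / ((M + 2 : ℝ) ^ (((m : ℝ) + 1) / 2)) *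
                Real.sqrt (nuT2 M β h q 1 (fun σs => f σs ^ 2)) := by
  refine ⟨1 / 20, by norm_num, fun n _ m => ?_⟩
  obtain ⟨K, hK⟩ := exists_rev_taylor_bound cavityMomentBound 9 (by norm_num) n m
  refine ⟨K, fun β hβ0 hβ M h _ q hq hq1 hfix f => ?_⟩
  simp only [nuT2_eq_rev]
  exact hK _ _ _ _ _ (by positivity) (cavity_pos M) (covRate_cav_self M β hq)
    (abs_covRate_cav_le_nine M (by nlinarith) hq hq1)
    (fun r s hs => rev_covRate_cav_pow_le M hβ0 hβ hq hq1 hfix r hs) f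

end
end
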